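/- Let K be a compact metrizable group and Γ a finitely generated group of commuting continuous automorphisms of K such that the center Z(Γ) of the action has DCC on K. Then the following are equivalent: (1) Γ is ergodic on K; (2) there exists α ∈ Γ which is mixing of all orders on K. -/

import Mathlib

open MeasureTheory Topology Set

set_option linter.unusedVariables false

namespace ErgZd

variable {K : Type*}

/-- The group of bi-continuous automorphisms of a topological group,
as a subgroup of `MulAut K`. -/
def ContAut (K : Type*) [Group K] [TopologicalSpace K] : Subgroup (MulAut K) where
  carrier := {α | Continuous α ∧ Continuous α.symm}
  one_mem' := ⟨continuous_id, continuous_id⟩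
  mul_mem' := fun {a b} ha hb => ⟨ha.1.comp hb.1, hb.2.comp ha.2⟩
  inv_mem' := fun {a} ha => ⟨ha.2, ha.1⟩

section Defs

variable [Group K] [TopologicalSpace K]

lemma ContAut.continuous (α : ↥(ContAut K)) : Continuous ⇑(α : MulAut K) := α.2.1

lemma ContAut.continuous_symm (α : ↥(ContAut K)) :
    Continuous ⇑(α : MulAut K).symm := α.2.2

/-- Ergodicity of the action of a set `S` of automorphisms with respect to `μ`:
every invariant Borel set is null or conull. -/
def ErgSet [MeasurableSpace K] (μ : Measure K) (S : Set ↥(ContAut K)) : Prop :=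
  ∀ A : Set K, MeasurableSet A → (∀ α ∈ S, (α : MulAut K) '' A = A) → μ A = 0 ∨ μ A = 1

/-- Ergodicity of a single automorphism: ergodicity of the group of its integer powers. -/
def ErgAut [MeasurableSpace K] (μ : Measure K) (α : ↥(ContAut K)) : Prop :=
  ErgSet μ (Set.range fun n : ℤ => α ^ n)

/-- Distality of the action of a set of automorphisms: for `x ≠ 1`, the identity is
not in the closure of the orbit of `x`. -/
def DistalSet (S : Set ↥(ContAut K)) : Prop :=
  ∀ x : K, x ≠ 1 → (1 : K) ∉ closure ((fun α : ↥(ContAut K) => (α : MulAut K) x) '' S)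

/-- Distality of a single automorphism. -/
def DistalAut (α : ↥(ContAut K)) : Prop := DistalSet (Set.range fun n : ℤ => α ^ n)

/-- The descending chain condition for an action: every decreasing
sequence of closed invariant subgroups is eventually constant. -/
def HasDCC (S : Set ↥(ContAut K)) : Prop :=
  ∀ C : ℕ → Subgroup K, (∀ n, IsClosed (C n : Set K)) → (∀ n, C (n + 1) ≤ C n) →
    (∀ n, ∀ α ∈ S, ∀ x, x ∈ C n ↔ (α : MulAut K) x ∈ C n) → ∃ N, ∀ n, N ≤ n → C n = C N

/-- Restriction of an automorphism to an invariant subgroup. -/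
def restrictAut (H : Subgroup K) (α : ↥(ContAut K))
    (h : ∀ x, x ∈ H ↔ (α : MulAut K) x ∈ H) : ↥(ContAut ↥H) := by
  refine ⟨⟨⟨fun x => ⟨(α : MulAut K) x, (h x).mp x.2⟩,
      fun x => ⟨(α : MulAut K).symm x, (h _).mpr (by simpa using x.2)⟩, ?_, ?_⟩, ?_⟩, ?_, ?_⟩
  · intro x; ext; simp
  · intro x; ext; simp
  · intro x y; ext; simp
  · exact Continuous.subtype_mk ((ContAut.continuous α).comp continuous_subtype_val) _
  · exact Continuous.subtype_mk ((ContAut.continuous_symm α).comp continuous_subtype_val) _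

@[simp] lemma restrictAut_coe (H : Subgroup K) (α : ↥(ContAut K))
    (h : ∀ x, x ∈ H ↔ (α : MulAut K) x ∈ H) (x : ↥H) :
    ((((restrictAut H α h) : MulAut ↥H) x : ↥H) : K) = (α : MulAut K) (x : K) := rfl

/-- The automorphism induced on the quotient by an invariant closed normal subgroup. -/
def quotAut (N : Subgroup K) [N.Normal] (α : ↥(ContAut K))
    (h : ∀ x, x ∈ N ↔ (α : MulAut K) x ∈ N) : ↥(ContAut (K ⧸ N)) := by
  have hmap : N.map ((α : MulAut K) : K ≃* K) = N := by
    ext y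
    constructor
    · rintro ⟨x, hx, rfl⟩; exact (h x).mp hx
    · intro hy
      exact ⟨(α : MulAut K).symm y, (h _).mpr (by simpa using hy), by simp⟩
  refine ⟨QuotientGroup.congr N N ((α : MulAut K) : K ≃* K) hmap, ?_, ?_⟩
  · apply (QuotientGroup.isQuotientMap_mk N).continuous_iff.mpr
    have : ⇑(QuotientGroup.congr N N ((α : MulAut K) : K ≃* K) hmap) ∘ (QuotientGroup.mk : K → K ⧸ N)
        = (QuotientGroup.mk : K → K ⧸ N) ∘ ⇑(α : MulAut K) := by
      funext x
      exact QuotientGroup.congr_mk N N _ hmap x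
    rw [this]
    exact QuotientGroup.continuous_mk.comp (ContAut.continuous α)
  · apply (QuotientGroup.isQuotientMap_mk N).continuous_iff.mpr
    have : ⇑(QuotientGroup.congr N N ((α : MulAut K) : K ≃* K) hmap).symm ∘ (QuotientGroup.mk : K → K ⧸ N)
        = (QuotientGroup.mk : K → K ⧸ N) ∘ ⇑((α : MulAut K) : K ≃* K).symm := by
      funext x
      rfl
    rw [this]
    exact QuotientGroup.continuous_mk.comp (ContAut.continuous_symm α)

end Defs

section Mixing

variable [Group K] [TopologicalSpace K]

/-- An automorphism is mixing of all orders: for every `r ≥ 2` and Borel sets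
`A 1, …, A r`, `μ (a^{m 1} A 1 ∩ ⋯ ∩ a^{m r} A r) → μ (A 1) ⋯ μ (A r)` as the minimum
of `|m i - m j|` (for `i ≠ j`) tends to infinity. -/
def MixingAllOrders [MeasurableSpace K] (μ : Measure K) (a : ↥(ContAut K)) : Prop :=
  ∀ r : ℕ, 2 ≤ r → ∀ A : Fin r → Set K, (∀ i, MeasurableSet (A i)) →
    ∀ ε : ℝ, 0 < ε → ∃ N : ℕ, ∀ m : Fin r → ℤ,
      (∀ i j, i ≠ j → (N : ℤ) ≤ |m i - m j|) →
      |(μ (⋂ i, ((a ^ (m i) : ↥(ContAut K)) : MulAut K) '' A i)).toReal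
        - ∏ i, (μ (A i)).toReal| < ε

end Mixing

set_option linter.unusedSectionVars false

section Recurrence

open Polynomial

variable {ι : Type*}

/-- The entries of the integer tuple `n` are pairwise at distance at least `N`. -/
def Gap (N : ℕ) (n : ι → ℤ) : Prop := ∀ i j, i ≠ j → (N : ℤ) ≤ |n i - n j|

lemma Gap.mono {N M : ℕ} {n : ι → ℤ} (h : Gap M n) (hNM : N ≤ M) : Gap N n :=
  fun i j hij => le_trans (by exact_mod_cast hNM) (h i j hij)

lemma exists_top_index [Fintype ι] {n : ι → ℕ} {N : ℕ} (hn : Gap N fun i => (n i : ℤ))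
    {p : ι → Prop} (hp : ∃ i, p i) :
    ∃ i₀, p i₀ ∧ ∀ i, i ≠ i₀ → p i → n i + N ≤ n i₀ := by
  classical
  obtain ⟨i₁, hi₁⟩ := hp
  obtain ⟨i₀, hi₀, hmax⟩ := Finset.exists_max_image (Finset.univ.filter p) n ⟨i₁, by simpa using hi₁⟩
  refine ⟨i₀, by simpa using hi₀, fun i hi hpi => ?_⟩
  have h1 := hmax i (by simpa using hpi)
  have h2 : (N : ℤ) ≤ |(n i₀ : ℤ) - n i| := hn i₀ i hi.symm
  rw [abs_of_nonneg (by omega)] at h2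
  omega

lemma exists_gap_of_absoluteValue [Fintype ι] {F : Type*} [Field F] (v : AbsoluteValue F ℝ) {t : F}
    (ht : 1 < v t) (c : ι → F) :
    ∃ N : ℕ, ∀ n : ι → ℕ, Gap N (fun i => (n i : ℤ)) → ∑ i, t ^ n i * c i = 0 → ∀ i, c i = 0 := by
  classical
  set C := ∑ i, v (c i) with hC
  have h1 : ∀ i, ∃ N : ℕ, c i ≠ 0 → ∀ M, N ≤ M → C < v t ^ M * v (c i) := by
    intro i
    by_cases hi : c i = 0
    · exact ⟨0, fun h => absurd hi h⟩
    · have hpos : 0 < v (c i) := v.pos hi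
      obtain ⟨N, hN⟩ := pow_unbounded_of_one_lt (C / v (c i)) ht
      refine ⟨N, fun _ M hM => ?_⟩
      rw [div_lt_iff₀ hpos] at hN
      exact hN.trans_le (by gcongr; exact ht.le)
  choose Nf hNf using h1
  refine ⟨∑ i, Nf i, fun n hn hsum => ?_⟩
  set N := ∑ i, Nf i
  by_contra! hex
  obtain ⟨i₀, hi₀, htop⟩ := exists_top_index hn (p := fun i => c i ≠ 0) hex
  have hlt := hNf i₀ hi₀ N (Finset.single_le_sum (f := Nf) (fun _ _ => Nat.zero_le _) (Finset.mem_univ i₀))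
  have heq : t ^ n i₀ * c i₀ = -∑ i ∈ Finset.univ.erase i₀, t ^ n i * c i := by
    rw [← Finset.add_sum_erase _ _ (Finset.mem_univ i₀)] at hsum
    exact eq_neg_of_add_eq_zero_left hsum
  have hle : v t ^ n i₀ * v (c i₀) ≤ ∑ i ∈ Finset.univ.erase i₀, v t ^ n i * v (c i) := by
    rw [← map_pow, ← map_mul, heq, AbsoluteValue.map_neg]
    refine (v.sum_le _ _).trans (le_of_eq ?_)
    simp
  have hle2 : v t ^ N * (v t ^ n i₀ * v (c i₀)) ≤ v t ^ n i₀ * C := by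
    calc v t ^ N * (v t ^ n i₀ * v (c i₀))
        ≤ v t ^ N * ∑ i ∈ Finset.univ.erase i₀, v t ^ n i * v (c i) := by gcongr
      _ = ∑ i ∈ Finset.univ.erase i₀, v t ^ N * (v t ^ n i * v (c i)) := by rw [Finset.mul_sum]
      _ ≤ ∑ i ∈ Finset.univ.erase i₀, v t ^ n i₀ * v (c i) := by
          refine Finset.sum_le_sum fun i hi => ?_
          by_cases hci : c i = 0
          · simp [hci]
          · rw [← mul_assoc, ← pow_add]
            have := htop i (Finset.ne_of_mem_erase hi) hci
            gcongr
            · exact ht.le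
            · omega
      _ ≤ ∑ i, v t ^ n i₀ * v (c i) :=
          Finset.sum_le_sum_of_subset_of_nonneg (Finset.erase_subset _ _)
            fun i _ _ => by positivity
      _ = v t ^ n i₀ * C := by rw [Finset.mul_sum]
  have hpos : 0 < v t ^ n i₀ := pow_pos (by linarith) _
  have : v t ^ n i₀ * (v t ^ N * v (c i₀)) ≤ v t ^ n i₀ * C := by linarith
  exact absurd (le_of_mul_le_mul_left this hpos) (not_le.2 hlt)

lemma exists_gap_of_absoluteValue_ne_one [Fintype ι] {F : Type*} [Field F] (v : AbsoluteValue F ℝ)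
    {t : F} (ht0 : t ≠ 0) (ht : v t ≠ 1) (c : ι → F) :
    ∃ N : ℕ, ∀ n : ι → ℕ, Gap N (fun i => (n i : ℤ)) → ∑ i, t ^ n i * c i = 0 → ∀ i, c i = 0 := by
  rcases ht.lt_or_gt with h | h
  · have h' : 1 < v t⁻¹ := by
      rw [map_inv₀]
      exact (one_lt_inv₀ (v.pos ht0)).2 h
    obtain ⟨N, hN⟩ := exists_gap_of_absoluteValue v h' c
    refine ⟨N, fun n hn hsum => ?_⟩
    set B := ∑ i, n i
    have hB : ∀ i, n i ≤ B := fun i =>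
      Finset.single_le_sum (f := n) (fun _ _ => Nat.zero_le _) (Finset.mem_univ i)
    refine hN (fun i => B - n i) (fun i j hij => ?_) ?_
    · have := hn i j hij
      have h1 := hB i
      have h2 := hB j
      rw [abs_sub_comm] at this
      push_cast [h1, h2]
      convert this using 2
      ring
    · have : ∑ i, t⁻¹ ^ (B - n i) * c i = t⁻¹ ^ B * ∑ i, t ^ n i * c i := by
        rw [Finset.mul_sum]
        refine Finset.sum_congr rfl fun i _ => ?_
        rw [← mul_assoc, inv_pow, inv_pow, pow_sub₀ _ ht0 (hB i)]
        simp [mul_comm]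
      rw [this, hsum, mul_zero]
  · exact exists_gap_of_absoluteValue v h c

lemma exists_gap_polynomial [Fintype ι] {F : Type*} [Field F] (p : ι → F[X]) :
    ∃ N : ℕ, ∀ n : ι → ℕ, Gap N (fun i => (n i : ℤ)) → ∑ i, X ^ n i * p i = 0 → ∀ i, p i = 0 := by
  classical
  refine ⟨1 + ∑ i, (p i).natDegree, fun n hn hsum => ?_⟩
  by_contra! hex
  obtain ⟨i₀, hi₀, htop⟩ := exists_top_index hn (p := fun i => p i ≠ 0) hex
  have h := congrArg (fun q => q.coeff ((p i₀).natDegree + n i₀)) hsum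
  simp only [finsetSum_coeff, coeff_zero] at h
  rw [Finset.sum_eq_single i₀] at h
  · rw [coeff_X_pow_mul] at h
    exact hi₀ (leadingCoeff_eq_zero.1 h)
  · intro i _ hi
    by_cases hpi : p i = 0
    · simp [hpi]
    · have h1 := htop i hi hpi
      have h2 : (p i).natDegree ≤ ∑ i, (p i).natDegree :=
        Finset.single_le_sum (f := fun i => (p i).natDegree) (fun _ _ => Nat.zero_le _)
          (Finset.mem_univ i)
      apply coeff_eq_zero_of_natDegree_lt
      refine (natDegree_mul_le).trans_lt ?_
      rw [natDegree_X_pow]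
      omega
  · simp

lemma exists_absoluteValue_ne_one (F : Type*) [Field F] [NumberField F] {t : F} (ht0 : t ≠ 0)
    (ht : ∀ k : ℕ, 0 < k → t ^ k ≠ 1) : ∃ v : AbsoluteValue F ℝ, v t ≠ 1 := by
  by_contra! hv
  have hintg : t ∈ (algebraMap (NumberField.RingOfIntegers F) F).range := by
    apply IsDedekindDomain.HeightOneSpectrum.mem_integers_of_valuation_le_one
    intro w
    have h := hv (IsDedekindDomain.HeightOneSpectrum.adicAbv w (K := F) (b := 2) (by norm_num))
    have h' : WithZeroMulInt.toNNReal (e := 2) (by norm_num) (w.valuation F t) =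
        WithZeroMulInt.toNNReal (e := 2) (by norm_num) 1 := by
      rw [map_one]
      exact NNReal.coe_injective h
    exact ((WithZeroMulInt.toNNReal_strictMono (by norm_num)).injective h').le
  obtain ⟨y, rfl⟩ := hintg
  obtain ⟨k, hk, h⟩ := NumberField.Embeddings.pow_eq_one_of_norm_eq_one F ℂ
    (NumberField.RingOfIntegers.isIntegral_coe y) (fun φ => hv (NumberField.place φ))
  exact ht k hk h

lemma exists_gap_field [Fintype ι] {F : Type*} [Field F] {t : F} (ht0 : t ≠ 0)
    (ht : ∀ k : ℕ, 0 < k → t ^ k ≠ 1) (p : ι → ℤ[X]) :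
    ∃ N : ℕ, ∀ n : ι → ℕ, Gap N (fun i => (n i : ℤ)) → ∑ i, t ^ n i * aeval t (p i) = 0 →
      ∀ i, aeval t (p i) = 0 := by
  have htrans : ∀ (k : Type) [Field k] [Algebra k F], Transcendental k t →
      ∃ N : ℕ, ∀ n : ι → ℕ, Gap N (fun i => (n i : ℤ)) → ∑ i, t ^ n i * aeval t (p i) = 0 →
      ∀ i, aeval t (p i) = 0 := by
    intro k _ _ htr
    have hmap : ∀ q : ℤ[X], aeval t (q.map (Int.castRingHom k)) = aeval t q := by
      intro q
      rw [show Int.castRingHom k = algebraMap ℤ k from RingHom.ext_int _ _, aeval_map_algebraMap]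
    obtain ⟨N, hN⟩ := exists_gap_polynomial fun i => (p i).map (Int.castRingHom k)
    refine ⟨N, fun n hn hsum i => ?_⟩
    rw [← hmap, hN n hn ?_ i, map_zero]
    apply transcendental_iff_injective.1 htr
    simp only [map_sum, map_mul, map_pow, aeval_X, map_zero]
    simpa only [hmap] using hsum
  obtain ⟨q, hq⟩ := CharP.exists F
  rcases CharP.char_is_prime_or_zero F q with hqp | rfl
  · have : Fact q.Prime := ⟨hqp⟩
    let : Algebra (ZMod q) F := ZMod.algebra F q
    refine htrans (ZMod q) fun halg => ?_
    have : FiniteDimensional (ZMod q) (IntermediateField.adjoin (ZMod q) {t}) :=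
      IntermediateField.adjoin.finiteDimensional halg.isIntegral
    have : Finite (IntermediateField.adjoin (ZMod q) {t}) := Module.finite_of_finite (ZMod q)
    let u : (IntermediateField.adjoin (ZMod q) {t})ˣ :=
      Units.mk0 (IntermediateField.AdjoinSimple.gen (ZMod q) t) (by
        intro h
        apply ht0
        rw [← IntermediateField.AdjoinSimple.coe_gen (ZMod q) t, h]
        rfl)
    have h1 := pow_orderOf_eq_one u
    refine ht (orderOf u) (orderOf_pos u) ?_
    have h2 := congrArg (fun w : (IntermediateField.adjoin (ZMod q) {t})ˣ =>
      ((w : IntermediateField.adjoin (ZMod q) {t}) : F)) h1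
    beta_reduce at h2
    rw [Units.val_pow_eq_pow_val, SubmonoidClass.coe_pow] at h2
    exact h2
  · have : CharZero F := CharP.charP_to_charZero F
    by_cases halg : Transcendental ℚ t
    · exact htrans ℚ halg
    have halg : IsAlgebraic ℚ t := not_not.1 halg
    have : FiniteDimensional ℚ (IntermediateField.adjoin ℚ {t}) :=
      IntermediateField.adjoin.finiteDimensional halg.isIntegral
    have : NumberField (IntermediateField.adjoin ℚ {t}) := ⟨⟩
    set g := IntermediateField.AdjoinSimple.gen ℚ t
    have hg : (algebraMap (IntermediateField.adjoin ℚ {t}) F) g = t :=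
      IntermediateField.AdjoinSimple.algebraMap_gen ℚ t
    have hinj := (algebraMap (IntermediateField.adjoin ℚ {t}) F).injective
    have hg0 : g ≠ 0 := fun h => ht0 (by rw [← hg, h, map_zero])
    obtain ⟨v, hv⟩ := exists_absoluteValue_ne_one _ hg0
      (fun k hk h => ht k hk (by rw [← hg, ← map_pow, h, map_one]))
    obtain ⟨N, hN⟩ := exists_gap_of_absoluteValue_ne_one v hg0 hv fun i => aeval g (p i)
    have hae : ∀ q : ℤ[X], algebraMap (IntermediateField.adjoin ℚ {t}) F (aeval g q) = aeval t q := by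
      intro q
      have := aeval_algebraMap_apply F g q
      rw [hg] at this
      exact this.symm
    refine ⟨N, fun n hn hsum i => ?_⟩
    rw [← hae, hN n hn ?_ i, map_zero]
    apply hinj
    simp only [map_sum, map_mul, map_pow, hae, hg, map_zero]
    exact hsum

lemma exists_gap_ringHom [Fintype ι] {F : Type*} [Field F] (f : ℤ[X] →+* F) (ht0 : f X ≠ 0)
    (ht : ∀ k : ℕ, 0 < k → f X ^ k ≠ 1) (p : ι → ℤ[X]) :
    ∃ N : ℕ, ∀ n : ι → ℕ, Gap N (fun i => (n i : ℤ)) → ∑ i, f X ^ n i * f (p i) = 0 →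
      ∀ i, f (p i) = 0 := by
  have hae : ∀ q, aeval (f X) q = f q := by
    intro q
    have : (aeval (f X) : ℤ[X] →ₐ[ℤ] F) = f.toIntAlgHom := by
      ext
      rw [aeval_X]
      rfl
    rw [this]
    rfl
  simpa only [hae] using exists_gap_field ht0 ht p

/-- The multiplicative set of `ℤ[X]` generated by `X` and the polynomials `X ^ k - 1`. -/
noncomputable def unitRootMonoid : Submonoid ℤ[X] :=
  Submonoid.closure ({X} ∪ {q | ∃ k : ℕ, 0 < k ∧ q = X ^ k - 1})

lemma exists_gap_of_finite [Fintype ι] (M : Type*) [AddCommGroup M] [Module ℤ[X] M]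
    [hfin : Module.Finite ℤ[X] M] : ∀ m : ι → M,
    ∃ N : ℕ, ∀ n : ι → ℕ, Gap N (fun i => (n i : ℤ)) → ∑ i, (X ^ n i : ℤ[X]) • m i = 0 →
      ∀ i, ∃ s ∈ unitRootMonoid, s • m i = 0 := by
  classical
  induction hfin using IsNoetherianRing.induction_on_isQuotientEquivQuotientPrime ℤ[X] with
  | subsingleton M =>
    exact fun m => ⟨0, fun n _ _ i => ⟨1, one_mem _, Subsingleton.elim _ _⟩⟩
  | quotient M P e =>
    intro m
    by_cases hP : ∃ s ∈ unitRootMonoid, s ∈ P.1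
    · obtain ⟨s, hs, hsP⟩ := hP
      refine ⟨0, fun n _ _ i => ⟨s, hs, e.injective ?_⟩⟩
      obtain ⟨q, hq⟩ := Ideal.Quotient.mk_surjective (e (m i))
      rw [map_smul, ← hq, map_zero, Algebra.smul_def, Ideal.Quotient.algebraMap_eq, ← map_mul,
        Ideal.Quotient.eq_zero_iff_mem]
      exact P.1.mul_mem_right _ hsP
    push Not at hP
    have := P.2
    let f : ℤ[X] →+* FractionRing (ℤ[X] ⧸ P.1) :=
      (algebraMap (ℤ[X] ⧸ P.1) (FractionRing (ℤ[X] ⧸ P.1))).comp (Ideal.Quotient.mk P.1)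
    have hinj : Function.Injective (algebraMap (ℤ[X] ⧸ P.1) (FractionRing (ℤ[X] ⧸ P.1))) :=
      IsFractionRing.injective _ _
    have hf : ∀ q, f q = 0 → Ideal.Quotient.mk P.1 q = 0 := fun q hq =>
      hinj (by rw [map_zero]; exact hq)
    have hne : ∀ q ∈ unitRootMonoid, f q ≠ 0 := fun q hq h =>
      hP q hq (Ideal.Quotient.eq_zero_iff_mem.1 (hf q h))
    have ht0 : f X ≠ 0 := hne X (Submonoid.subset_closure (Or.inl rfl))
    have ht1 : ∀ k : ℕ, 0 < k → f X ^ k ≠ 1 := by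
      intro k hk h
      apply hne (X ^ k - 1) (Submonoid.subset_closure (Or.inr ⟨k, hk, rfl⟩))
      rw [map_sub, map_pow, map_one, h, sub_self]
    choose q hq using fun i => Ideal.Quotient.mk_surjective (e (m i))
    obtain ⟨N, hN⟩ := exists_gap_ringHom f ht0 ht1 q
    refine ⟨N, fun n hn hsum i => ⟨1, one_mem _, ?_⟩⟩
    have := hN n hn ?_ i
    · have h2 := hf _ this
      rw [hq] at h2
      rw [one_smul]
      exact (map_eq_zero_iff _ e.injective).1 h2
    · have h3 := congrArg (fun x => algebraMap (ℤ[X] ⧸ P.1) (FractionRing (ℤ[X] ⧸ P.1)) (e x)) hsum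
      simp only [map_sum, map_smul, map_zero] at h3
      rw [← h3]
      refine Finset.sum_congr rfl fun i _ => ?_
      rw [Algebra.smul_def, map_mul, ← hq, Ideal.Quotient.algebraMap_eq, map_pow, map_pow]
      rfl
  | exact M₁ M₂ M₃ f g hf hg hfg h₁ h₃ =>
    intro m
    obtain ⟨N₃, hN₃⟩ := h₃ fun i => g (m i)
    have himg : ∀ n : ι → ℕ, ∑ i, (X ^ n i : ℤ[X]) • m i = 0 →
        ∑ i, (X ^ n i : ℤ[X]) • g (m i) = 0 := by
      intro n h
      rw [← map_zero g, ← h]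
      simp [map_sum]
    by_cases htor : ∀ i, ∃ s ∈ unitRootMonoid, s • g (m i) = 0
    · choose s hs hsm using htor
      have hprod : ∀ i, g ((∏ j, s j) • m i) = 0 := by
        intro i
        rw [map_smul, ← Finset.mul_prod_erase _ _ (Finset.mem_univ i), mul_comm, mul_smul, hsm,
          smul_zero]
      choose m' hm' using fun i => (hfg _).1 (hprod i)
      obtain ⟨N₁, hN₁⟩ := h₁ m'
      refine ⟨N₁, fun n hn hsum i => ?_⟩
      have key := hN₁ n hn (hf ?_) i
      · obtain ⟨u, hu, hum⟩ := key
        refine ⟨u * ∏ j, s j, mul_mem hu (prod_mem fun j _ => hs j), ?_⟩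
        rw [mul_smul, ← hm', ← map_smul, hum, map_zero]
      · simp only [map_sum, map_smul, hm', map_zero]
        rw [← smul_zero (∏ j, s j), ← hsum, Finset.smul_sum]
        exact Finset.sum_congr rfl fun i _ => smul_comm _ _ _
    · exact ⟨N₃, fun n hn hsum => absurd (hN₃ n hn (himg n hsum)) htor⟩

/-- If `T` is an injective endomorphism of an abelian group such that no nonzero element is
periodic, then tuples of elements satisfy no relation `∑ T ^ (n i) (m i) = 0` with widely spaced
exponents, unless they vanish. -/
lemma exists_gap_of_aperiodic [Fintype ι] {M : Type*} [AddCommGroup M] (T : M →+ M)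
    (hT : Function.Injective T) (hper : ∀ k : ℕ, 0 < k → ∀ x, T^[k] x = x → x = 0) (m : ι → M) :
    ∃ N : ℕ, ∀ n : ι → ℕ, Gap N (fun i => (n i : ℤ)) → ∑ i, T^[n i] (m i) = 0 → ∀ i, m i = 0 := by
  let φ : M →ₗ[ℤ] M := T.toIntLinearMap
  let of := Module.AEval'.of φ
  have hX : ∀ (k : ℕ) (x : M), (X ^ k : ℤ[X]) • of x = of (T^[k] x) := by
    intro k x
    induction k with
    | zero => simp
    | succ k ih =>
      rw [pow_succ', mul_smul, ih, Module.AEval'.X_smul_of, Function.iterate_succ_apply']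
      rfl
  let S : Submodule ℤ[X] (Module.AEval' φ) := Submodule.span ℤ[X] (range fun i => of (m i))
  have : Module.Finite ℤ[X] S := Module.Finite.span_of_finite _ (finite_range _)
  obtain ⟨N, hN⟩ := exists_gap_of_finite S
    fun i => ⟨of (m i), Submodule.subset_span ⟨i, rfl⟩⟩
  have htf : ∀ s ∈ unitRootMonoid, ∀ x : Module.AEval' φ, s • x = 0 → x = 0 := by
    intro s hs
    induction hs using Submonoid.closure_induction with
    | mem s hs =>
      intro x hx
      obtain ⟨x, rfl⟩ := of.surjective x
      rcases hs with rfl | ⟨k, hk, rfl⟩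
      · have := hX 1 x
        rw [pow_one, hx] at this
        have h2 : T x = 0 := by
          simpa using (of.map_eq_zero_iff.1 this.symm)
        rw [(map_eq_zero_iff T hT).1 h2, map_zero]
      · rw [sub_smul, one_smul, hX, sub_eq_zero] at hx
        rw [hper k hk x (of.injective hx), map_zero]
    | one => intro x hx; simpa using hx
    | mul s u _ _ hs hu => intro x hx; exact hu x (hs _ (by rwa [← mul_smul]))
  refine ⟨N, fun n hn hsum i => ?_⟩
  have key := hN n hn (Subtype.ext ?_) i
  · obtain ⟨s, hs, h⟩ := key
    have h2 := congrArg Subtype.val h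
    have := htf s hs _ h2
    exact of.map_eq_zero_iff.1 this
  · simp only [AddSubmonoidClass.coe_finsetSum, Submodule.coe_smul, hX, Submodule.coe_zero]
    rw [← map_sum, hsum, map_zero]

end Recurrence

section Translations

variable {K : Type*} [Group K] [TopologicalSpace K] [IsTopologicalGroup K]

/-- The two-sided translate `x ↦ f (a * x * b)` of a continuous function. -/
noncomputable def translate (a b : K) : C(K, ℂ) →⋆ₐ[ℂ] C(K, ℂ) :=
  ContinuousMap.compStarAlgHom' ℂ ℂ ⟨fun x => a * x * b, by fun_prop⟩

/-- The composition `f ∘ γ` of a continuous function with an automorphism. -/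
noncomputable def pull (γ : ↥(ContAut K)) : C(K, ℂ) →⋆ₐ[ℂ] C(K, ℂ) :=
  ContinuousMap.compStarAlgHom' ℂ ℂ ⟨(γ : MulAut K), ContAut.continuous γ⟩

@[simp] lemma translate_apply (a b : K) (f : C(K, ℂ)) (x : K) :
    translate a b f x = f (a * x * b) := rfl

@[simp] lemma pull_apply (γ : ↥(ContAut K)) (f : C(K, ℂ)) (x : K) :
    pull γ f x = f ((γ : MulAut K) x) := rfl

lemma translate_translate (a b c d : K) (f : C(K, ℂ)) :
    translate a b (translate c d f) = translate (c * a) (b * d) f := by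
  ext x; simp [mul_assoc]

@[simp] lemma translate_one_one (f : C(K, ℂ)) : translate 1 1 f = f := by
  ext x; simp

lemma pull_pull (γ δ : ↥(ContAut K)) (f : C(K, ℂ)) : pull γ (pull δ f) = pull (δ * γ) f := by
  ext x; simp

@[simp] lemma pull_one (f : C(K, ℂ)) : pull 1 f = f := by
  ext x; simp

@[simp] lemma pull_pull_inv (γ : ↥(ContAut K)) (f : C(K, ℂ)) : pull γ (pull γ⁻¹ f) = f := by
  rw [pull_pull, inv_mul_cancel, pull_one]

@[simp] lemma pull_inv_pull (γ : ↥(ContAut K)) (f : C(K, ℂ)) : pull γ⁻¹ (pull γ f) = f := by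
  rw [pull_pull, mul_inv_cancel, pull_one]

lemma translate_pull (a b : K) (γ : ↥(ContAut K)) (f : C(K, ℂ)) :
    translate a b (pull γ f) =
      pull γ (translate ((γ : MulAut K) a) ((γ : MulAut K) b) f) := by
  ext x; simp

/-- Invariance of a set of functions under all two-sided translations. -/
def BiInv (V : Set C(K, ℂ)) : Prop := ∀ a b, ∀ f ∈ V, translate a b f ∈ V

/-- Invariance of a set of functions under composition with `γ`. -/
def PullInv (γ : ↥(ContAut K)) (V : Set C(K, ℂ)) : Prop := ∀ f ∈ V, pull γ f ∈ V

lemma PullInv.mem_iff {γ : ↥(ContAut K)} {V : Set C(K, ℂ)} (h : PullInv γ V) (h' : PullInv γ⁻¹ V)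
    (f : C(K, ℂ)) : pull γ f ∈ V ↔ f ∈ V :=
  ⟨fun hf => by simpa using h' _ hf, h f⟩

end Translations

section Inner

variable {K : Type*} [Group K] [TopologicalSpace K] [IsTopologicalGroup K]
  [CompactSpace K] [MeasurableSpace K] [BorelSpace K]
  (μ : Measure K) [μ.IsHaarMeasure] [IsProbabilityMeasure μ]

lemma measurePreserving_contAut (γ : ↥(ContAut K)) :
    MeasurePreserving (γ : MulAut K) μ μ :=
  MonoidHom.measurePreserving (f := ((γ : MulAut K) : K ≃* K).toMonoidHom)
    (ContAut.continuous γ) (MulEquiv.surjective _) rfl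

lemma measurePreserving_translate (a b : K) :
    MeasurePreserving (fun x => a * x * b) μ μ := by
  have hc : MeasurePreserving (MulAut.conj b⁻¹) μ μ :=
    MonoidHom.measurePreserving (f := (MulAut.conj b⁻¹).toMonoidHom)
      (by
        change Continuous fun x => b⁻¹ * x * b⁻¹⁻¹
        fun_prop) (MulEquiv.surjective _) rfl
  convert (measurePreserving_mul_left μ (a * b)).comp hc using 1
  funext x
  simp [mul_assoc]

lemma integral_translate (a b : K) (f : C(K, ℂ)) : ∫ x, translate a b f x ∂μ = ∫ x, f x ∂μ := by
  have h : IsClosedEmbedding fun x : K => a * x * b :=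
    ((Homeomorph.mulLeft a).trans (Homeomorph.mulRight b)).isClosedEmbedding
  exact (measurePreserving_translate μ a b).integral_comp h.measurableEmbedding f

lemma integral_pull (γ : ↥(ContAut K)) (f : C(K, ℂ)) : ∫ x, pull γ f x ∂μ = ∫ x, f x ∂μ := by
  have h : IsClosedEmbedding (γ : MulAut K) :=
    (Homeomorph.mk ((γ : MulAut K) : K ≃* K).toEquiv (ContAut.continuous γ)
      (ContAut.continuous_symm γ)).isClosedEmbedding
  exact (measurePreserving_contAut μ γ).integral_comp h.measurableEmbedding f

lemma integrable_continuousMap (f : C(K, ℂ)) : Integrable f μ :=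
  f.continuous.integrable_of_hasCompactSupport (HasCompactSupport.of_compactSpace _)

/-- The embedding of the continuous functions into `L²`. -/
noncomputable abbrev toL2 : C(K, ℂ) →L[ℂ] Lp ℂ 2 μ := ContinuousMap.toLp 2 μ ℂ

/-- The `L²` inner product of continuous functions. -/
noncomputable def ip (f g : C(K, ℂ)) : ℂ := inner ℂ (toL2 μ f) (toL2 μ g)

lemma ip_def (f g : C(K, ℂ)) : ip μ f g = ∫ x, (star f * g) x ∂μ := by
  rw [ip, ContinuousMap.inner_toLp]
  refine integral_congr_ae (.of_forall fun x => ?_)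
  simp [mul_comm]

lemma ip_translate (a b : K) (f g : C(K, ℂ)) :
    ip μ (translate a b f) (translate a b g) = ip μ f g := by
  rw [ip_def, ip_def, ← map_star, ← map_mul, integral_translate]

lemma ip_pull (γ : ↥(ContAut K)) (f g : C(K, ℂ)) : ip μ (pull γ f) (pull γ g) = ip μ f g := by
  rw [ip_def, ip_def, ← map_star, ← map_mul, integral_pull]

lemma ip_sub_right (f g h : C(K, ℂ)) : ip μ f (g - h) = ip μ f g - ip μ f h := by
  simp [ip, inner_sub_right]

lemma ip_smul_right (c : ℂ) (f g : C(K, ℂ)) : ip μ f (c • g) = c * ip μ f g := by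
  simp [ip, inner_smul_right]

lemma ip_zero_right (f : C(K, ℂ)) : ip μ f 0 = 0 := by simp [ip]
lemma ip_conj (f g : C(K, ℂ)) : star (ip μ f g) = ip μ g f := inner_conj_symm _ _

lemma ip_comm_zero {f g : C(K, ℂ)} (h : ip μ f g = 0) : ip μ g f = 0 := by
  rw [← ip_conj, h, star_zero]

lemma eq_zero_of_ip_self {f : C(K, ℂ)} (h : ip μ f f = 0) : f = 0 := by
  have h1 : toL2 μ f = 0 := inner_self_eq_zero.1 h
  exact ContinuousMap.toLp_injective (p := 2) (𝕜 := ℂ) μ (by rw [map_zero]; exact h1)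

lemma ip_one_left (f : C(K, ℂ)) : ip μ 1 f = ∫ x, f x ∂μ := by
  rw [ip_def, star_one, one_mul]

lemma ip_translate_left (a b : K) (f g : C(K, ℂ)) :
    ip μ (translate a b f) g = ip μ f (translate a⁻¹ b⁻¹ g) := by
  rw [← ip_translate μ a b f, translate_translate]
  simp

lemma ip_pull_left (γ : ↥(ContAut K)) (f g : C(K, ℂ)) :
    ip μ (pull γ f) g = ip μ f (pull γ⁻¹ g) := by
  rw [← ip_pull μ γ f, pull_pull_inv]

end Inner

section Projection

variable {K : Type*} [Group K] [TopologicalSpace K] [IsTopologicalGroup K]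
  [CompactSpace K] [MeasurableSpace K] [BorelSpace K]
  (μ : Measure K) [μ.IsHaarMeasure] [IsProbabilityMeasure μ]

/-- A finite-dimensional space of functions invariant under two-sided translations. -/
structure IsRepr (V : Submodule ℂ C(K, ℂ)) : Prop where
  fin : FiniteDimensional ℂ V
  biInv : BiInv (V : Set C(K, ℂ))

/-- The orthogonal projection onto a finite-dimensional space of continuous functions. -/
noncomputable def proj (V : Submodule ℂ C(K, ℂ)) [FiniteDimensional ℂ V] :
    C(K, ℂ) →L[ℂ] C(K, ℂ) :=
  let e := Submodule.equivMapOfInjective (toL2 μ : C(K, ℂ) →ₗ[ℂ] Lp ℂ 2 μ)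
    (ContinuousMap.toLp_injective (p := 2) (𝕜 := ℂ) μ) V
  V.subtypeL ∘L (LinearMap.toContinuousLinearMap (e.symm : _ →ₗ[ℂ] V)) ∘L
    (V.map (toL2 μ : C(K, ℂ) →ₗ[ℂ] Lp ℂ 2 μ)).orthogonalProjectionOnto ∘L toL2 μ

lemma proj_mem (V : Submodule ℂ C(K, ℂ)) [FiniteDimensional ℂ V] (f : C(K, ℂ)) :
    proj μ V f ∈ V := Submodule.coe_mem _

lemma toL2_proj (V : Submodule ℂ C(K, ℂ)) [FiniteDimensional ℂ V] (f : C(K, ℂ)) :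
    toL2 μ (proj μ V f) =
      (V.map (toL2 μ : C(K, ℂ) →ₗ[ℂ] Lp ℂ 2 μ)).orthogonalProjectionOnto (toL2 μ f) := by
  set e := Submodule.equivMapOfInjective (toL2 μ : C(K, ℂ) →ₗ[ℂ] Lp ℂ 2 μ)
    (ContinuousMap.toLp_injective (p := 2) (𝕜 := ℂ) μ) V with he
  set w := (V.map (toL2 μ : C(K, ℂ) →ₗ[ℂ] Lp ℂ 2 μ)).orthogonalProjectionOnto (toL2 μ f)
  have h1 : proj μ V f = (e.symm w : C(K, ℂ)) := rfl
  rw [h1]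
  have h2 := Submodule.coe_equivMapOfInjective_apply (toL2 μ : C(K, ℂ) →ₗ[ℂ] Lp ℂ 2 μ)
    (ContinuousMap.toLp_injective (p := 2) (𝕜 := ℂ) μ) V (e.symm w)
  rw [← he, LinearEquiv.apply_symm_apply] at h2
  exact h2.symm

lemma ip_sub_proj (V : Submodule ℂ C(K, ℂ)) [FiniteDimensional ℂ V] (f : C(K, ℂ))
    {g : C(K, ℂ)} (hg : g ∈ V) : ip μ g (f - proj μ V f) = 0 := by
  rw [ip, map_sub, toL2_proj]
  exact Submodule.inner_right_of_mem_orthogonal (Submodule.mem_map_of_mem hg)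
    (Submodule.sub_starProjection_mem_orthogonal _)

lemma ip_proj (V : Submodule ℂ C(K, ℂ)) [FiniteDimensional ℂ V] (f : C(K, ℂ))
    {g : C(K, ℂ)} (hg : g ∈ V) : ip μ g (proj μ V f) = ip μ g f := by
  have := ip_sub_proj μ V f hg
  rw [ip_sub_right, sub_eq_zero] at this
  exact this.symm

lemma eq_of_ip_eq {V : Submodule ℂ C(K, ℂ)} {f g : C(K, ℂ)} (hf : f ∈ V) (hg : g ∈ V)
    (h : ∀ v ∈ V, ip μ v f = ip μ v g) : f = g := by
  rw [← sub_eq_zero]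
  apply eq_zero_of_ip_self μ
  rw [ip_sub_right, h _ (V.sub_mem hf hg), sub_self]

lemma proj_eq_self (V : Submodule ℂ C(K, ℂ)) [FiniteDimensional ℂ V] {f : C(K, ℂ)} (hf : f ∈ V) :
    proj μ V f = f :=
  eq_of_ip_eq μ (proj_mem μ V f) hf fun _ hv => ip_proj μ V f hv

lemma proj_translate {V : Submodule ℂ C(K, ℂ)} [FiniteDimensional ℂ V]
    (hV : BiInv (V : Set C(K, ℂ))) (a b : K) (f : C(K, ℂ)) :
    proj μ V (translate a b f) = translate a b (proj μ V f) := by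
  refine eq_of_ip_eq μ (proj_mem _ _ _) (hV a b _ (proj_mem _ _ _)) fun v hv => ?_
  have h : v = translate a b (translate a⁻¹ b⁻¹ v) := by rw [translate_translate]; simp
  rw [ip_proj μ V _ hv, h, ip_translate, ip_translate, ip_proj μ V _ (hV _ _ _ hv)]

lemma exists_reproducing (V : Submodule ℂ C(K, ℂ)) [FiniteDimensional ℂ V] :
    ∃ e ∈ V, ∀ f ∈ V, ip μ e f = f 1 := by
  set E := Submodule.equivMapOfInjective (toL2 μ : C(K, ℂ) →ₗ[ℂ] Lp ℂ 2 μ)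
    (ContinuousMap.toLp_injective (p := 2) (𝕜 := ℂ) μ) V with hE
  have hEv : ∀ v : V, ((E v : _) : Lp ℂ 2 μ) = toL2 μ v := fun v =>
    Submodule.coe_equivMapOfInjective_apply _ _ _ _
  let ev : V →ₗ[ℂ] ℂ :=
    { toFun := fun f => (f : C(K, ℂ)) 1
      map_add' := fun f g => rfl
      map_smul' := fun c f => rfl }
  let ℓ := LinearMap.toContinuousLinearMap (ev ∘ₗ E.symm.toLinearMap)
  have : CompleteSpace (V.map (toL2 μ : C(K, ℂ) →ₗ[ℂ] Lp ℂ 2 μ)) :=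
    FiniteDimensional.complete ℂ _
  let w := (InnerProductSpace.toDual ℂ _).symm ℓ
  refine ⟨E.symm w, Submodule.coe_mem _, fun f hf => ?_⟩
  have h1 : inner ℂ w (E ⟨f, hf⟩) = ℓ (E ⟨f, hf⟩) := InnerProductSpace.toDual_symm_apply
  have h2 : ℓ (E ⟨f, hf⟩) = f 1 := by
    change ev (E.symm (E ⟨f, hf⟩)) = f 1
    rw [LinearEquiv.symm_apply_apply]
    rfl
  rw [← h2, ← h1, ip, ← hEv, LinearEquiv.apply_symm_apply, Submodule.coe_inner]
  congr 1

lemma proj_apply {V : Submodule ℂ C(K, ℂ)} [FiniteDimensional ℂ V]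
    (hV : BiInv (V : Set C(K, ℂ))) {e : C(K, ℂ)} (heV : e ∈ V) (he : ∀ f ∈ V, ip μ e f = f 1)
    (f : C(K, ℂ)) (x : K) : proj μ V f x = ip μ e (translate x 1 f) := by
  have h : proj μ V f x = translate x 1 (proj μ V f) 1 := by simp
  rw [h, ← proj_translate μ hV, ← he _ (proj_mem _ _ _), ip_proj μ V _ heV]

/-- The projection onto a representation space preserves every representation space. -/
lemma proj_mem_of_mem {V W : Submodule ℂ C(K, ℂ)} [FiniteDimensional ℂ V]
    (hV : BiInv (V : Set C(K, ℂ))) [FiniteDimensional ℂ W] (hW : BiInv (W : Set C(K, ℂ)))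
    {f : C(K, ℂ)} (hf : f ∈ W) : proj μ V f ∈ W := by
  obtain ⟨e, heV, he⟩ := exists_reproducing μ V
  set h := proj μ V f with hh
  set g := h - proj μ W h with hg
  have hgW : ∀ w ∈ W, ip μ g w = 0 := fun w hw => ip_comm_zero μ (ip_sub_proj μ W h hw)
  have h0 : ip μ g h = 0 := by
    have h1 : ip μ g h = ∫ x, ∫ y, star (g x) * (star (e y) * f (x * y)) ∂μ ∂μ := by
      rw [ip_def]
      refine integral_congr_ae (.of_forall fun x => ?_)
      change star (g x) * h x = _
      rw [hh, proj_apply μ hV heV he, ip_def, ← integral_const_mul]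
      refine integral_congr_ae (.of_forall fun y => ?_)
      simp
    rw [h1, integral_integral_swap_of_hasCompactSupport (by fun_prop)
      (HasCompactSupport.of_compactSpace _)]
    rw [integral_eq_zero_of_ae]
    refine .of_forall fun y => ?_
    have h2 := hgW _ (hW 1 y f hf)
    rw [ip_def] at h2
    have h3 : ∀ x, star (g x) * (star (e y) * f (x * y)) =
        star (e y) * (star g * translate 1 y f) x := by
      intro x
      simp
      ring
    simp only [h3, integral_const_mul, h2]
    simp
  have h1 : g = 0 := by
    apply eq_zero_of_ip_self μ
    nth_rw 2 [hg]
    rw [ip_sub_right, h0, hgW _ (proj_mem _ _ _), sub_zero]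
  rw [sub_eq_zero.1 h1]
  exact proj_mem _ _ _

end Projection

section Repr

variable {K : Type*} [Group K] [TopologicalSpace K] [IsTopologicalGroup K] [CompactSpace K]

lemma BiInv.sup {V W : Submodule ℂ C(K, ℂ)} (hV : BiInv (V : Set C(K, ℂ)))
    (hW : BiInv (W : Set C(K, ℂ))) : BiInv ((V ⊔ W : Submodule ℂ C(K, ℂ)) : Set C(K, ℂ)) := by
  intro a b f hf
  obtain ⟨v, hv, w, hw, rfl⟩ := Submodule.mem_sup.1 hf
  rw [map_add]
  exact Submodule.add_mem_sup (hV a b v hv) (hW a b w hw)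

lemma PullInv.sup {γ : ↥(ContAut K)} {V W : Submodule ℂ C(K, ℂ)}
    (hV : PullInv γ (V : Set C(K, ℂ))) (hW : PullInv γ (W : Set C(K, ℂ))) :
    PullInv γ ((V ⊔ W : Submodule ℂ C(K, ℂ)) : Set C(K, ℂ)) := by
  intro f hf
  obtain ⟨v, hv, w, hw, rfl⟩ := Submodule.mem_sup.1 hf
  rw [map_add]
  exact Submodule.add_mem_sup (hV v hv) (hW w hw)

lemma BiInv.mul {V W : Submodule ℂ C(K, ℂ)} (hV : BiInv (V : Set C(K, ℂ)))
    (hW : BiInv (W : Set C(K, ℂ))) : BiInv ((V * W : Submodule ℂ C(K, ℂ)) : Set C(K, ℂ)) := by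
  intro a b f hf
  refine Submodule.mul_induction_on hf (fun v hv w hw => ?_) fun f g hf hg => ?_
  · rw [map_mul]
    exact Submodule.mul_mem_mul (hV a b v hv) (hW a b w hw)
  · rw [map_add]
    exact Submodule.add_mem _ hf hg

lemma PullInv.mul {γ : ↥(ContAut K)} {V W : Submodule ℂ C(K, ℂ)}
    (hV : PullInv γ (V : Set C(K, ℂ))) (hW : PullInv γ (W : Set C(K, ℂ))) :
    PullInv γ ((V * W : Submodule ℂ C(K, ℂ)) : Set C(K, ℂ)) := by
  intro f hf
  refine Submodule.mul_induction_on hf (fun v hv w hw => ?_) fun f g hf hg => ?_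
  · rw [map_mul]
    exact Submodule.mul_mem_mul (hV v hv) (hW w hw)
  · rw [map_add]
    exact Submodule.add_mem _ hf hg

lemma IsRepr.sup {V W : Submodule ℂ C(K, ℂ)} (hV : IsRepr V) (hW : IsRepr W) :
    IsRepr (V ⊔ W) := by
  have := hV.fin
  have := hW.fin
  exact ⟨inferInstance, hV.biInv.sup hW.biInv⟩

lemma IsRepr.mul {V W : Submodule ℂ C(K, ℂ)} (hV : IsRepr V) (hW : IsRepr W) :
    IsRepr (V * W) := by
  have hV' := Module.Finite.iff_fg.1 hV.fin
  have hW' := Module.Finite.iff_fg.1 hW.fin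
  exact ⟨Module.Finite.iff_fg.2 (hV'.mul hW'), hV.biInv.mul hW.biInv⟩

lemma IsRepr.inf {V M : Submodule ℂ C(K, ℂ)} (hV : IsRepr V) (hM : BiInv (M : Set C(K, ℂ))) :
    IsRepr (V ⊓ M) := by
  have := hV.fin
  exact ⟨Submodule.finiteDimensional_of_le inf_le_left,
    fun a b f hf => ⟨hV.biInv a b f hf.1, hM a b f hf.2⟩⟩

/-- Composition with an automorphism as a linear map. -/
noncomputable abbrev pullₗ (γ : ↥(ContAut K)) : C(K, ℂ) →ₗ[ℂ] C(K, ℂ) :=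
  ((pull γ : C(K, ℂ) →⋆ₐ[ℂ] C(K, ℂ)) : C(K, ℂ) →ₐ[ℂ] C(K, ℂ)).toLinearMap

lemma mem_map_pull {γ : ↥(ContAut K)} {V : Submodule ℂ C(K, ℂ)} {f : C(K, ℂ)} :
    f ∈ V.map (pullₗ γ) ↔ pull γ⁻¹ f ∈ V := by
  constructor
  · rintro ⟨g, hg, rfl⟩
    change pull γ⁻¹ (pull γ g) ∈ V
    rwa [pull_inv_pull]
  · intro h
    exact ⟨_, h, pull_pull_inv γ f⟩

lemma pull_mem_map {γ : ↥(ContAut K)} {V : Submodule ℂ C(K, ℂ)} {f : C(K, ℂ)} (hf : f ∈ V) :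
    pull γ f ∈ V.map (pullₗ γ) := ⟨f, hf, rfl⟩

lemma map_pull_map_pull (γ δ : ↥(ContAut K)) (V : Submodule ℂ C(K, ℂ)) :
    (V.map (pullₗ δ)).map (pullₗ γ) = V.map (pullₗ (δ * γ)) := by
  ext f
  rw [mem_map_pull, mem_map_pull, mem_map_pull, pull_pull, mul_inv_rev]

@[simp] lemma map_pull_one (V : Submodule ℂ C(K, ℂ)) : V.map (pullₗ 1) = V := by
  ext f
  rw [mem_map_pull, inv_one, pull_one]

lemma BiInv.map_pull {V : Submodule ℂ C(K, ℂ)} (hV : BiInv (V : Set C(K, ℂ)))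
    (γ : ↥(ContAut K)) : BiInv ((V.map (pullₗ γ) : Submodule ℂ C(K, ℂ)) : Set C(K, ℂ)) := by
  intro a b f hf
  rw [SetLike.mem_coe, mem_map_pull] at hf ⊢
  have h2 : pull γ⁻¹ (translate a b f) =
      translate ((γ : MulAut K) a) ((γ : MulAut K) b) (pull γ⁻¹ f) := by
    rw [translate_pull]
    simp
  rw [h2]
  exact hV _ _ _ hf

lemma IsRepr.map_pull {V : Submodule ℂ C(K, ℂ)} (hV : IsRepr V) (γ : ↥(ContAut K)) :
    IsRepr (V.map (pullₗ γ)) := by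
  have := hV.fin
  exact ⟨inferInstance, hV.biInv.map_pull γ⟩

lemma IsRepr.iSup {ι : Type*} [Finite ι] {V : ι → Submodule ℂ C(K, ℂ)} (hV : ∀ i, IsRepr (V i)) :
    IsRepr (⨆ i, V i) := by
  have := fun i => (hV i).fin
  refine ⟨inferInstance, fun a b f hf => ?_⟩
  have h : (⨆ i, V i) ≤ (⨆ i, V i).comap
      ((translate a b : C(K, ℂ) →⋆ₐ[ℂ] C(K, ℂ)) : C(K, ℂ) →ₐ[ℂ] C(K, ℂ)).toLinearMap :=
    iSup_le fun i f hf => Submodule.mem_iSup_of_mem i ((hV i).biInv a b f hf)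
  exact h hf

/-- The star-subalgebra of functions contained in a finite-dimensional translation-invariant
space of functions that is invariant under the automorphisms in `S`. -/
noncomputable def finAlg (S : Subgroup ↥(ContAut K)) : StarSubalgebra ℂ C(K, ℂ) where
  carrier := {f | ∃ V : Submodule ℂ C(K, ℂ), IsRepr V ∧ (∀ γ ∈ S, PullInv γ (V : Set C(K, ℂ))) ∧
    f ∈ V}
  mul_mem' := by
    rintro f g ⟨V, hV, hVS, hf⟩ ⟨W, hW, hWS, hg⟩
    exact ⟨V * W, hV.mul hW, fun γ hγ => (hVS γ hγ).mul (hWS γ hγ), Submodule.mul_mem_mul hf hg⟩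
  add_mem' := by
    rintro f g ⟨V, hV, hVS, hf⟩ ⟨W, hW, hWS, hg⟩
    exact ⟨V ⊔ W, hV.sup hW, fun γ hγ => (hVS γ hγ).sup (hWS γ hγ), Submodule.add_mem_sup hf hg⟩
  algebraMap_mem' := by
    intro c
    refine ⟨1, ⟨Module.Finite.iff_fg.2 (Submodule.one_eq_span (R := ℂ) (A := C(K, ℂ)) ▸ Submodule.fg_span_singleton 1), ?_⟩, ?_, ?_⟩
    · intro a b f hf
      obtain ⟨c, rfl⟩ := Submodule.mem_one.1 hf
      rw [AlgHomClass.commutes]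
      exact hf
    · intro γ _ f hf
      obtain ⟨c, rfl⟩ := Submodule.mem_one.1 hf
      rw [AlgHomClass.commutes]
      exact hf
    · exact Submodule.mem_one.2 ⟨c, rfl⟩
  star_mem' := by
    rintro f ⟨V, hV, hVS, hf⟩
    have hV' := Module.Finite.iff_fg.1 hV.fin
    refine ⟨V.map (starLinearEquiv ℂ : C(K, ℂ) ≃ₗ⋆[ℂ] C(K, ℂ)).toLinearMap,
      ⟨Module.Finite.iff_fg.2 (hV'.map _), ?_⟩, ?_, ⟨f, hf, rfl⟩⟩
    · rintro a b _ ⟨g, hg, rfl⟩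
      exact ⟨translate a b g, hV.biInv a b g hg, map_star (translate a b) g⟩
    · rintro γ hγ _ ⟨g, hg, rfl⟩
      exact ⟨pull γ g, hVS γ hγ g hg, map_star (pull γ) g⟩

lemma mem_finAlg {S : Subgroup ↥(ContAut K)} {f : C(K, ℂ)} :
    f ∈ finAlg S ↔ ∃ V : Submodule ℂ C(K, ℂ), IsRepr V ∧
      (∀ γ ∈ S, PullInv γ (V : Set C(K, ℂ))) ∧ f ∈ V := Iff.rfl

lemma finAlg_anti {S T : Subgroup ↥(ContAut K)} (h : S ≤ T) : finAlg T ≤ finAlg S := by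
  rintro f ⟨V, hV, hVS, hf⟩
  exact ⟨V, hV, fun γ hγ => hVS γ (h hγ), hf⟩

lemma finAlg_biInv (S : Subgroup ↥(ContAut K)) : BiInv (finAlg S : Set C(K, ℂ)) := by
  rintro a b f ⟨V, hV, hVS, hf⟩
  exact ⟨V, hV, hVS, hV.biInv a b f hf⟩

lemma finAlg_pullInv {S : Subgroup ↥(ContAut K)} {β : ↥(ContAut K)}
    (hβ : ∀ γ ∈ S, β * γ = γ * β) : PullInv β (finAlg S : Set C(K, ℂ)) := by
  rintro f ⟨V, hV, hVS, hf⟩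
  refine ⟨V.map (pullₗ β), hV.map_pull β, ?_, pull_mem_map hf⟩
  intro γ hγ g hg
  rw [SetLike.mem_coe, mem_map_pull] at hg ⊢
  have : pull β⁻¹ (pull γ g) = pull γ (pull β⁻¹ g) := by
    have hc : Commute β γ := hβ γ hγ
    rw [pull_pull, pull_pull, hc.inv_left.eq]
  rw [this]
  exact hVS γ hγ _ hg

/-- A minimal nonzero finite-dimensional translation-invariant space of functions. -/
structure Irred (U : Submodule ℂ C(K, ℂ)) : Prop where
  repr : IsRepr U
  ne_bot : U ≠ ⊥
  min : ∀ W, IsRepr W → W ≤ U → W ≠ ⊥ → W = U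

lemma Irred.map_pull {U : Submodule ℂ C(K, ℂ)} (hU : Irred U) (γ : ↥(ContAut K)) :
    Irred (U.map (pullₗ γ)) := by
  have hb : ∀ (δ : ↥(ContAut K)) {W : Submodule ℂ C(K, ℂ)}, W ≠ ⊥ → W.map (pullₗ δ) ≠ ⊥ := by
    intro δ W hW h
    apply hW
    rw [← map_pull_one W, ← mul_inv_cancel δ, ← map_pull_map_pull, h, Submodule.map_bot]
  refine ⟨hU.repr.map_pull γ, hb γ hU.ne_bot, fun W hW hWU hW0 => ?_⟩
  have h1 := hU.min (W.map (pullₗ γ⁻¹)) (hW.map_pull _) ?_ (hb _ hW0)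
  · rw [← h1, map_pull_map_pull, inv_mul_cancel, map_pull_one]
  · rw [← map_pull_one U, ← mul_inv_cancel γ, ← map_pull_map_pull]
    exact Submodule.map_mono hWU

lemma exists_irred_le {V : Submodule ℂ C(K, ℂ)} (hV : IsRepr V) (h0 : V ≠ ⊥) :
    ∃ U ≤ V, Irred U := by
  induction hn : Module.finrank ℂ V using Nat.strong_induction_on generalizing V with
  | _ n ih =>
    by_cases hirr : Irred V
    · exact ⟨V, le_rfl, hirr⟩
    have : ∃ W, IsRepr W ∧ W ≤ V ∧ W ≠ ⊥ ∧ W ≠ V := by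
      by_contra! hcon
      exact hirr ⟨hV, h0, hcon⟩
    obtain ⟨W, hW, hWV, hW0, hne⟩ := this
    have := hV.fin
    obtain ⟨U, hU, hirr⟩ := ih _ (hn ▸ Submodule.finrank_lt_finrank_of_lt (lt_of_le_of_ne hWV hne))
      hW hW0 rfl
    exact ⟨U, hU.trans hWV, hirr⟩

variable [MeasurableSpace K] [BorelSpace K]
  (μ : Measure K) [μ.IsHaarMeasure] [IsProbabilityMeasure μ]

lemma le_of_irred_le (μ : Measure K) [μ.IsHaarMeasure] [IsProbabilityMeasure μ] {V : Submodule ℂ C(K, ℂ)} (hV : IsRepr V) (M : Submodule ℂ C(K, ℂ))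
    (h : ∀ U ≤ V, Irred U → U ≤ M) : V ≤ M := by
  induction hn : Module.finrank ℂ V using Nat.strong_induction_on generalizing V with
  | _ n ih =>
    by_cases h0 : V = ⊥
    · rw [h0]; exact bot_le
    obtain ⟨U, hUV, hU⟩ := exists_irred_le hV h0
    have := hV.fin
    have := hU.repr.fin
    set W := V ⊓ LinearMap.ker (proj μ U).toLinearMap with hWdef
    have hW : IsRepr W := hV.inf (by
      intro a b f hf
      change proj μ U (translate a b f) = 0
      have hf' : proj μ U f = 0 := hf
      rw [proj_translate μ hU.repr.biInv, hf', map_zero])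
    have hWV : W < V := by
      refine lt_of_le_of_ne inf_le_left fun heq => hU.ne_bot ?_
      rw [eq_bot_iff]
      intro u hu
      have h1 : u ∈ W := heq ▸ hUV hu
      have h2 : proj μ U u = 0 := h1.2
      rw [proj_eq_self μ U hu] at h2
      exact (Submodule.mem_bot ℂ).2 h2
    have hWM := ih _ (hn ▸ Submodule.finrank_lt_finrank_of_lt hWV) hW
      (fun U' hU' hirr => h U' (hU'.trans hWV.le) hirr) rfl
    intro f hf
    have hp : proj μ U f ∈ U := proj_mem _ _ _
    have h3 : f - proj μ U f ∈ W := by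
      refine ⟨V.sub_mem hf (hUV hp), ?_⟩
      change proj μ U (f - proj μ U f) = 0
      rw [map_sub, proj_eq_self μ U hp, sub_self]
    rw [← sub_add_cancel f (proj μ U f)]
    exact M.add_mem (hWM h3) (h U hUV hU hp)

lemma Irred.ip_eq_zero {U V : Submodule ℂ C(K, ℂ)} (hU : Irred U) (hV : Irred V) (hne : U ≠ V)
    {u v : C(K, ℂ)} (hu : u ∈ U) (hv : v ∈ V) : ip μ u v = 0 := by
  have := hU.repr.fin
  have := hV.repr.fin
  have h1 : proj μ U v ∈ U ⊓ V :=
    ⟨proj_mem _ _ _, proj_mem_of_mem μ hU.repr.biInv hV.repr.biInv hv⟩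
  have h2 : U ⊓ V = ⊥ := by
    by_contra h
    have hr := hU.repr.inf hV.repr.biInv
    exact hne ((hU.min _ hr inf_le_left h).symm.trans (hV.min _ hr inf_le_right h))
  rw [h2, Submodule.mem_bot] at h1
  rw [← ip_proj μ U v hu, h1, ip_zero_right]

end Repr

section CompactOperator

variable {X : Type*} [TopologicalSpace X] [CompactSpace X]
  {H : Type*} [NormedAddCommGroup H] [InnerProductSpace ℂ H]

/-- The operator `f ↦ ⟪Φ ·, f⟫` into continuous functions. -/
noncomputable def innerOp (Φ : C(X, H)) : H →L[ℂ] C(X, ℂ) :=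
  LinearMap.mkContinuous
    { toFun := fun f => ⟨fun x => inner ℂ (Φ x) f, by fun_prop⟩
      map_add' := fun f g => by ext x; simp
      map_smul' := fun c f => by ext x; simp } ‖Φ‖ fun f => by
    refine (ContinuousMap.norm_le _ (by positivity)).2 fun x => ?_
    refine (norm_inner_le_norm _ _).trans ?_
    gcongr
    exact ContinuousMap.norm_coe_le_norm Φ x

lemma isCompactOperator_innerOp (Φ : C(X, H)) : IsCompactOperator (innerOp Φ) := by
  have hmem : innerOp Φ ∈ closure {T : H →L[ℂ] C(X, ℂ) | IsCompactOperator T} := by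
    rw [Metric.mem_closure_iff]
    intro ε hε
    have htb := (isCompact_range Φ.continuous).totallyBounded
    obtain ⟨t, htf, ht⟩ := Metric.totallyBounded_iff.1 htb (ε / 2) (by positivity)
    have : FiniteDimensional ℂ (Submodule.span ℂ t) := FiniteDimensional.span_of_finite ℂ htf
    set F := Submodule.span ℂ t
    refine ⟨(innerOp Φ ∘L F.subtypeL) ∘L F.orthogonalProjectionOnto, ?_, ?_⟩
    · change IsCompactOperator ((innerOp Φ ∘L F.subtypeL) ∘ F.orthogonalProjectionOnto)
      have : ProperSpace F := FiniteDimensional.proper ℂ F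
      exact (isCompactOperator_of_locallyCompactSpace_rng
        (innerOp Φ ∘L F.subtypeL)).comp_clm _
    · rw [dist_eq_norm]
      refine lt_of_le_of_lt (ContinuousLinearMap.opNorm_le_bound _ (by positivity) fun f => ?_)
        (half_lt_self hε)
      refine (ContinuousMap.norm_le _ (by positivity)).2 fun x => ?_
      change ‖inner ℂ (Φ x) f - inner ℂ (Φ x) (F.starProjection f)‖ ≤ _
      have h1 : inner ℂ (Φ x) f - inner ℂ (Φ x) (F.starProjection f) =
          inner ℂ (Φ x - F.starProjection (Φ x)) f := by
        rw [inner_sub_left, Submodule.inner_starProjection_left_eq_right]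
      rw [h1]
      refine (norm_inner_le_norm _ _).trans ?_
      gcongr
      obtain ⟨y, hy, hxy⟩ := mem_iUnion₂.1 (ht (mem_range_self x))
      rw [Metric.mem_ball, dist_eq_norm] at hxy
      rw [Submodule.starProjection_minimal]
      refine le_trans (ciInf_le ⟨0, ?_⟩ (⟨y, Submodule.subset_span hy⟩ : F)) hxy.le
      rintro _ ⟨z, rfl⟩
      exact norm_nonneg _
  rwa [isClosed_setOfPred_isCompactOperator.closure_eq] at hmem

end CompactOperator

section PeterWeyl

variable {K : Type*} [Group K] [TopologicalSpace K] [IsTopologicalGroup K] [CompactSpace K]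

lemma continuous_translate (f : C(K, ℂ)) : Continuous fun p : K × K => translate p.1 p.2 f :=
  ContinuousMap.continuous_of_continuous_uncurry _ (by
    change Continuous fun q : (K × K) × K => f (q.1.1 * q.2 * q.1.2)
    fun_prop)

variable [MeasurableSpace K] [BorelSpace K]

section Convolution

variable (μ : Measure K) [μ.IsHaarMeasure] [IsProbabilityMeasure μ] (φ : C(K, ℂ))

/-- The `L²`-valued kernel of convolution with `φ`. -/
noncomputable def convKernel : C(K, Lp ℂ 2 μ) :=
  ⟨fun x => toL2 μ (translate x⁻¹ 1 φ), (toL2 μ).continuous.comp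
    ((continuous_translate φ).comp (by fun_prop : Continuous fun x : K => (x⁻¹, (1 : K))))⟩

/-- Convolution with `φ`. -/
noncomputable def convOp : C(K, ℂ) →L[ℂ] C(K, ℂ) := innerOp (convKernel μ φ) ∘L toL2 μ

lemma convOp_apply (h : C(K, ℂ)) (x : K) : convOp μ φ h x = ip μ (translate x⁻¹ 1 φ) h := rfl

variable {φ}

lemma convOp_translate (hφ : ∀ a y, φ (a * y * a⁻¹) = φ y) (a b : K) (h : C(K, ℂ)) :
    convOp μ φ (translate a b h) = translate a b (convOp μ φ h) := by
  ext x
  have h1 : ∀ c d, translate c d φ = translate (d * c) 1 φ := by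
    intro c d
    ext y
    rw [translate_apply, translate_apply, ← hφ d]
    congr 1
    group
  rw [convOp_apply, translate_apply, convOp_apply, ← inv_inv a, ← inv_inv b, ← ip_translate_left,
    translate_translate, h1]
  congr 2
  simp [mul_assoc]

lemma ip_convOp (hφ : ∀ y, star (φ y) = φ y⁻¹) (u v : C(K, ℂ)) :
    ip μ (convOp μ φ u) v = ip μ u (convOp μ φ v) := by
  have h1 : ip μ (convOp μ φ u) v = ∫ x, ∫ y, φ (x⁻¹ * y) * star (u y) * v x ∂μ ∂μ := by
    rw [ip_def]
    refine integral_congr_ae (.of_forall fun x => ?_)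
    change star (convOp μ φ u x) * v x = _
    rw [convOp_apply, ip_conj, ip_def, ← integral_mul_const]
    refine integral_congr_ae (.of_forall fun y => ?_)
    simp [mul_comm]
  have h2 : ip μ u (convOp μ φ v) = ∫ y, ∫ x, φ (x⁻¹ * y) * star (u y) * v x ∂μ ∂μ := by
    rw [ip_def]
    refine integral_congr_ae (.of_forall fun y => ?_)
    change star (u y) * (convOp μ φ v y) = _
    rw [convOp_apply, ip_def, ← integral_const_mul]
    refine integral_congr_ae (.of_forall fun x => ?_)
    have := hφ (y⁻¹ * x)
    rw [mul_inv_rev, inv_inv] at this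
    simp only [ContinuousMap.mul_apply, ContinuousMap.star_apply, translate_apply, mul_one,
      this]
    ring
  rw [h1, h2, integral_integral_swap_of_hasCompactSupport (by fun_prop)
    (HasCompactSupport.of_compactSpace _)]

/-- A class function invariant under a translation provided that all representative functions
are. -/
lemma apply_eq_of_finAlg (μ : Measure K) [μ.IsHaarMeasure] [IsProbabilityMeasure μ] {φ : C(K, ℂ)}
    [T2Space K] (hφ : ∀ a y, φ (a * y * a⁻¹) = φ y)
    (hφ' : ∀ y, star (φ y) = φ y⁻¹) {x : K} (hx : ∀ f ∈ finAlg (⊥ : Subgroup ↥(ContAut K)), f x = f 1) :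
    φ x⁻¹ = φ 1 := by
  set S := innerOp (convKernel μ φ)
  set T : Lp ℂ 2 μ →L[ℂ] Lp ℂ 2 μ := toL2 μ ∘L S with hT
  have hinj := ContinuousMap.toLp_injective (p := 2) (𝕜 := ℂ) (E := ℂ) μ
  have hTc : IsCompactOperator T := (isCompactOperator_innerOp _).clm_comp (toL2 μ)
  have hsymm : (T : Lp ℂ 2 μ →ₗ[ℂ] Lp ℂ 2 μ).IsSymmetric := by
    have hd : DenseRange (toL2 μ) := ContinuousMap.toLp_denseRange ℂ μ ℂ (by norm_num)
    intro f g
    change inner ℂ (T f) g = inner ℂ f (T g)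
    induction f, g using hd.induction_on₂ with
    | hp => exact isClosed_eq (by fun_prop) (by fun_prop)
    | h u v => exact ip_convOp μ hφ' u v
  have hort := ContinuousLinearMap.orthogonalComplement_iSup_eigenspaces_eq_bot hTc hsymm
  have hmem : convKernel μ φ x - convKernel μ φ 1 ∈
      (⨆ l, Module.End.eigenspace (T : Lp ℂ 2 μ →ₗ[ℂ] Lp ℂ 2 μ) l)ᗮ := by
    rw [Submodule.mem_orthogonal']
    have hle : (⨆ l, Module.End.eigenspace (T : Lp ℂ 2 μ →ₗ[ℂ] Lp ℂ 2 μ) l) ≤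
        LinearMap.ker (innerSL ℂ (convKernel μ φ x - convKernel μ φ 1)).toLinearMap := by
      refine iSup_le fun l f hf => ?_
      rw [Module.End.mem_eigenspace_iff] at hf
      have hf : toL2 μ (S f) = l • f := hf
      change inner ℂ (convKernel μ φ x - convKernel μ φ 1) f = 0
      rw [inner_sub_left, sub_eq_zero]
      change S f x = S f 1
      by_cases hl : l = 0
      · rw [hl, zero_smul] at hf
        have : S f = 0 := hinj (by rw [map_zero]; exact hf)
        rw [this]
        rfl
      apply hx
      let V : Submodule ℂ C(K, ℂ) := LinearMap.ker (convOp μ φ - l • ContinuousLinearMap.id ℂ _).toLinearMap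
      have hV : ∀ h, h ∈ V ↔ convOp μ φ h = l • h := fun h => by
        change convOp μ φ h - l • h = 0 ↔ _
        rw [sub_eq_zero]
      refine ⟨V, ⟨?_, ?_⟩, ?_, ?_⟩
      · have hfd := ContinuousLinearMap.finite_dimensional_eigenspace hTc l hl
        refine Module.Finite.of_injective (((toL2 μ : C(K, ℂ) →ₗ[ℂ] Lp ℂ 2 μ).domRestrict V).codRestrict
          (Module.End.eigenspace (T : Lp ℂ 2 μ →ₗ[ℂ] Lp ℂ 2 μ) l) ?_) ?_
        · intro h
          rw [Module.End.mem_eigenspace_iff]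
          have := congrArg (toL2 μ) ((hV h).1 h.2)
          rw [map_smul] at this
          exact this
        · intro a b hab
          exact Subtype.ext (hinj (congrArg Subtype.val hab))
      · intro a b h hh
        rw [SetLike.mem_coe, hV] at hh ⊢
        rw [convOp_translate μ hφ, hh, map_smul]
      · intro γ hγ h hh
        rw [Subgroup.mem_bot] at hγ
        rwa [hγ, pull_one]
      · rw [hV]
        change S (toL2 μ (S f)) = _
        rw [hf, map_smul]
    intro f hf
    exact hle hf
  rw [hort, Submodule.mem_bot, sub_eq_zero] at hmem
  have h2 : translate x⁻¹ 1 φ = translate 1⁻¹ 1 φ := hinj hmem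
  have h3 := congrArg (fun f : C(K, ℂ) => f 1) h2
  simpa using h3

end Convolution

lemma exists_class_function [TopologicalSpace.MetrizableSpace K] (μ : Measure K) [μ.IsHaarMeasure]
    [IsProbabilityMeasure μ] {x : K} (hx : x ≠ 1) :
    ∃ φ : C(K, ℂ), (∀ a y, φ (a * y * a⁻¹) = φ y) ∧ (∀ y, star (φ y) = φ y⁻¹) ∧ φ x ≠ φ 1 := by
  let _ := TopologicalSpace.metrizableSpaceMetric K
  let ψ : K → ℝ := fun y => dist y 1 + dist y⁻¹ 1
  have hψ : Continuous ψ := by fun_prop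
  let F : K → ℝ := fun y => ∫ g, ψ (g * y * g⁻¹) ∂μ
  have hF : Continuous F := by
    have := continuous_parametric_integral_of_continuous (μ := μ)
      (f := fun y g => ψ (g * y * g⁻¹)) (by fun_prop) isCompact_univ
    simpa using this
  refine ⟨⟨fun y => (F y : ℂ), by fun_prop⟩, fun a y => ?_, fun y => ?_, ?_⟩
  · change (F (a * y * a⁻¹) : ℂ) = F y
    congr 1
    have h : IsClosedEmbedding fun g : K => 1 * g * a :=
      ((Homeomorph.mulLeft 1).trans (Homeomorph.mulRight a)).isClosedEmbedding
    have := (measurePreserving_translate μ 1 a).integral_comp h.measurableEmbedding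
      (fun g => ψ (g * y * g⁻¹))
    refine Eq.trans ?_ this
    refine integral_congr_ae (.of_forall fun g => ?_)
    simp [mul_assoc]
  · change star (F y : ℂ) = F y⁻¹
    have h1 : F y⁻¹ = F y := by
      refine integral_congr_ae (.of_forall fun g => ?_)
      have : (g * y * g⁻¹)⁻¹ = g * y⁻¹ * g⁻¹ := by group
      simp only [ψ, ← this, inv_inv]
      rw [add_comm]
    rw [h1]
    exact Complex.conj_ofReal _
  · have h1 : F 1 = 0 := by simp [F, ψ]
    have h2 : 0 < F x := by
      refine Continuous.integral_pos_of_hasCompactSupport_nonneg_nonzero (x := 1) (by fun_prop)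
        (HasCompactSupport.of_compactSpace _) (fun g => by simp only [ψ]; positivity) ?_
      have : 0 < dist x 1 := dist_pos.2 hx
      have h3 : 0 ≤ dist x⁻¹ 1 := dist_nonneg
      simp only [ψ, one_mul, inv_one, mul_one]
      positivity
    change (F x : ℂ) ≠ F 1
    rw [h1]
    exact_mod_cast ne_of_gt h2

/-- The Peter–Weyl theorem: representative functions are dense. -/
theorem finAlg_bot_dense [TopologicalSpace.MetrizableSpace K] (μ : Measure K) [μ.IsHaarMeasure]
    [IsProbabilityMeasure μ] :
    (finAlg (⊥ : Subgroup ↥(ContAut K))).topologicalClosure = ⊤ := by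
  apply ContinuousMap.starSubalgebra_topologicalClosure_eq_top_of_separatesPoints
  intro x y hxy
  have hne : y⁻¹ * x ≠ 1 := fun h => hxy (inv_mul_eq_one.1 h).symm
  have : ∃ f ∈ finAlg (⊥ : Subgroup ↥(ContAut K)), f (y⁻¹ * x) ≠ f 1 := by
    by_contra! hcon
    obtain ⟨φ, h1, h2, h3⟩ := exists_class_function μ (inv_ne_one.2 hne)
    exact h3 (apply_eq_of_finAlg μ h1 h2 hcon)
  obtain ⟨f, hf, hfx⟩ := this
  exact ⟨_, ⟨translate y⁻¹ 1 f, finAlg_biInv _ _ _ _ hf, rfl⟩, by simpa using hfx⟩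

end PeterWeyl

section FinAlg

variable {K : Type*} [Group K] [TopologicalSpace K] [IsTopologicalGroup K] [CompactSpace K]

/-- The automorphisms preserving a space of functions. -/
def pullStab (V : Submodule ℂ C(K, ℂ)) : Subgroup ↥(ContAut K) where
  carrier := {γ | V.map (pullₗ γ) = V}
  one_mem' := map_pull_one V
  mul_mem' := by
    intro γ δ hγ hδ
    change V.map (pullₗ (γ * δ)) = V
    rw [← map_pull_map_pull, hγ, hδ]
  inv_mem' := by
    intro γ hγ
    change V.map (pullₗ γ⁻¹) = V
    have hγ : V.map (pullₗ γ) = V := hγ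
    nth_rewrite 1 [← hγ]
    rw [map_pull_map_pull, mul_inv_cancel, map_pull_one]

lemma mem_pullStab {V : Submodule ℂ C(K, ℂ)} {γ : ↥(ContAut K)} :
    γ ∈ pullStab V ↔ V.map (pullₗ γ) = V := Iff.rfl

lemma pullInv_of_mem_pullStab {V : Submodule ℂ C(K, ℂ)} {γ : ↥(ContAut K)} (h : γ ∈ pullStab V) :
    PullInv γ (V : Set C(K, ℂ)) := fun f hf => by
  rw [mem_pullStab] at h
  rw [← h]
  exact pull_mem_map hf

lemma le_pullStab {V : Submodule ℂ C(K, ℂ)} {S : Subgroup ↥(ContAut K)} :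
    S ≤ pullStab V ↔ ∀ γ ∈ S, PullInv γ (V : Set C(K, ℂ)) := by
  refine ⟨fun h γ hγ => pullInv_of_mem_pullStab (h hγ), fun h γ hγ => ?_⟩
  rw [mem_pullStab]
  ext f
  rw [mem_map_pull]
  have := (h _ (S.inv_mem hγ)).mem_iff (by rw [inv_inv]; exact h γ hγ) f
  exact this

lemma mem_finAlg' {S : Subgroup ↥(ContAut K)} {f : C(K, ℂ)} :
    f ∈ finAlg S ↔ ∃ V : Submodule ℂ C(K, ℂ), IsRepr V ∧ S ≤ pullStab V ∧ f ∈ V := by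
  simp_rw [le_pullStab]
  exact mem_finAlg

lemma BiInv.iSup {ι : Sort*} {V : ι → Submodule ℂ C(K, ℂ)}
    (hV : ∀ i, BiInv (V i : Set C(K, ℂ))) :
    BiInv ((⨆ i, V i : Submodule ℂ C(K, ℂ)) : Set C(K, ℂ)) := by
  intro a b f hf
  have h : (⨆ i, V i) ≤ (⨆ i, V i).comap
      ((translate a b : C(K, ℂ) →⋆ₐ[ℂ] C(K, ℂ)) : C(K, ℂ) →ₐ[ℂ] C(K, ℂ)).toLinearMap :=
    iSup_le fun i f hf => Submodule.mem_iSup_of_mem i (hV i a b f hf)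
  exact h hf

lemma mem_finAlg_sup_zpowers {S : Subgroup ↥(ContAut K)} {γ : ↥(ContAut K)}
    (hγ : ∀ s ∈ S, Commute γ s) {V W : Submodule ℂ C(K, ℂ)} (hV : BiInv (V : Set C(K, ℂ)))
    (hS : S ≤ pullStab V) [FiniteDimensional ℂ W]
    (hW : ∀ n : ℤ, V.map (pullₗ (γ ^ n)) ≤ W) {f : C(K, ℂ)} (hf : f ∈ V) :
    f ∈ finAlg (S ⊔ Subgroup.zpowers γ) := by
  refine mem_finAlg'.2 ⟨⨆ n : ℤ, V.map (pullₗ (γ ^ n)),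
    ⟨Submodule.finiteDimensional_of_le (iSup_le hW), BiInv.iSup fun n => hV.map_pull _⟩,
    sup_le (fun s hs => ?_) ?_, Submodule.mem_iSup_of_mem 0 (by simpa using hf)⟩
  · rw [mem_pullStab, Submodule.map_iSup]
    refine iSup_congr fun n => ?_
    have hc : Commute (γ ^ n) s := (hγ s hs).zpow_left n
    rw [map_pull_map_pull, hc.eq, ← map_pull_map_pull, mem_pullStab.1 (hS hs)]
  · rw [Subgroup.zpowers_le, mem_pullStab, Submodule.map_iSup]
    refine (Equiv.addRight (1 : ℤ)).iSup_congr fun n => ?_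
    rw [map_pull_map_pull, Equiv.coe_addRight, zpow_add_one]

lemma exists_isRepr_of_le_finAlg {S : Subgroup ↥(ContAut K)} {V : Submodule ℂ C(K, ℂ)}
    (hV : V.FG) (h : ∀ f ∈ V, f ∈ finAlg S) :
    ∃ W : Submodule ℂ C(K, ℂ), IsRepr W ∧ S ≤ pullStab W ∧ V ≤ W := by
  induction V, hV using Submodule.fg_induction with
  | singleton x =>
    obtain ⟨W, hW, hS, hx⟩ := mem_finAlg'.1 (h x (Submodule.mem_span_singleton_self x))
    exact ⟨W, hW, hS, (Submodule.span_singleton_le_iff_mem _ _).2 hx⟩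
  | sup M N _ _ hM hN =>
    obtain ⟨W, hW, hS, hMW⟩ := hM fun f hf => h f (Submodule.mem_sup_left hf)
    obtain ⟨W', hW', hS', hNW⟩ := hN fun f hf => h f (Submodule.mem_sup_right hf)
    rw [le_pullStab] at hS hS'
    exact ⟨W ⊔ W', hW.sup hW', le_pullStab.2 fun γ hγ => (hS γ hγ).sup (hS' γ hγ),
      sup_le_sup hMW hNW⟩

lemma mem_finAlg_sup {S : Subgroup ↥(ContAut K)} {γ : ↥(ContAut K)}
    (hγ : ∀ s ∈ S, Commute γ s) {f : C(K, ℂ)} (hf : f ∈ finAlg S)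
    (hf' : f ∈ finAlg (Subgroup.zpowers γ)) : f ∈ finAlg (S ⊔ Subgroup.zpowers γ) := by
  obtain ⟨V, hV, hS, hfV⟩ := mem_finAlg.1 hf
  set M : Submodule ℂ C(K, ℂ) := (finAlg (Subgroup.zpowers γ)).toSubmodule with hM
  have hr : IsRepr (V ⊓ M) := hV.inf (finAlg_biInv _)
  have hst : S ≤ pullStab (V ⊓ M) := by
    refine le_pullStab.2 fun s hs g hg => ⟨hS s hs g hg.1, ?_⟩
    refine finAlg_pullInv (fun δ hδ => ?_) g hg.2
    obtain ⟨n, rfl⟩ := Subgroup.mem_zpowers_iff.1 hδ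
    exact ((hγ s hs).zpow_left n).symm.eq
  obtain ⟨W, hW, hWγ, hle⟩ := exists_isRepr_of_le_finAlg (S := Subgroup.zpowers γ)
    (Module.Finite.iff_fg.1 hr.fin) fun f hf => hf.2
  have := hW.fin
  refine mem_finAlg_sup_zpowers hγ hr.biInv hst (W := W) (fun n => ?_) ⟨hfV, hf'⟩
  refine (Submodule.map_mono hle).trans_eq ?_
  exact mem_pullStab.1 (hWγ (Subgroup.zpow_mem_zpowers γ n))

lemma mem_finAlg_of_pow {γ : ↥(ContAut K)} {k : ℕ} (hk : 0 < k) {f : C(K, ℂ)}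
    (hf : f ∈ finAlg (Subgroup.zpowers (γ ^ k))) : f ∈ finAlg (Subgroup.zpowers γ) := by
  obtain ⟨V, hV, hS, hfV⟩ := mem_finAlg'.1 hf
  have hfd := (IsRepr.iSup (ι := Fin k) fun j => hV.map_pull (γ ^ (j : ℕ))).fin
  have := mem_finAlg_sup_zpowers (S := ⊥) (γ := γ) (by simp) hV.biInv bot_le
    (W := ⨆ j : Fin k, V.map (pullₗ (γ ^ (j : ℕ)))) (fun n => ?_) hfV
  · simpa using this
  have hk' : (0 : ℤ) < k := by exact_mod_cast hk
  have h0 := Int.emod_nonneg n hk'.ne'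
  have hlt := Int.emod_lt_of_pos n hk'
  have h1 : γ ^ n = (γ ^ k) ^ (n / k) * γ ^ (n % k).toNat := by
    rw [← zpow_natCast, ← zpow_natCast, ← zpow_mul, ← zpow_add, Int.toNat_of_nonneg h0,
      Int.mul_ediv_add_emod]
  rw [h1, ← map_pull_map_pull, mem_pullStab.1 (hS (Subgroup.zpow_mem_zpowers _ _))]
  exact le_iSup (fun j : Fin k => V.map (pullₗ (γ ^ (j : ℕ)))) ⟨(n % k).toNat, by omega⟩

end FinAlg

section Ergodic

variable {K : Type*} [Group K] [TopologicalSpace K] [IsTopologicalGroup K] [CompactSpace K]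
  [MeasurableSpace K] [BorelSpace K] (μ : Measure K) [μ.IsHaarMeasure] [IsProbabilityMeasure μ]

lemma ErgSet.apply_eq {μ : Measure K} [μ.IsHaarMeasure] [IsProbabilityMeasure μ]
    {S : Set ↥(ContAut K)} (h : ErgSet μ S) {e : C(K, ℂ)} (he : ∀ γ ∈ S, pull γ e = e) (x y : K) :
    e x = e y := by
  by_contra hne
  obtain ⟨U, V, hU, hV, hx, hy, hd⟩ := t2_separation hne
  have hinv : ∀ T : Set ℂ, ∀ γ ∈ S, (γ : MulAut K) '' (e ⁻¹' T) = e ⁻¹' T := by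
    intro T γ hγ
    have hpt : ∀ z, e ((γ : MulAut K) z) = e z := fun z =>
      congrArg (fun f : C(K, ℂ) => f z) (he γ hγ)
    ext z
    constructor
    · rintro ⟨w, hw, rfl⟩
      rw [mem_preimage, hpt]
      exact hw
    · intro hz
      refine ⟨(γ : MulAut K).symm z, ?_, by simp⟩
      rw [mem_preimage, ← hpt]
      simpa using hz
  have hpos : ∀ T : Set ℂ, IsOpen T → (∃ z, e z ∈ T) → μ (e ⁻¹' T) = 1 := by
    rintro T hT ⟨z, hz⟩
    have ho : IsOpen (e ⁻¹' T) := hT.preimage e.continuous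
    exact (h _ ho.measurableSet (hinv T)).resolve_left (ho.measure_ne_zero μ ⟨z, hz⟩)
  have h1 := hpos U hU ⟨x, hx⟩
  have h2 := hpos V hV ⟨y, hy⟩
  have h3 := measure_union (μ := μ) (hd.preimage e) (hV.preimage e.continuous).measurableSet
  rw [h1, h2] at h3
  have h4 := prob_le_one (μ := μ) (s := e ⁻¹' U ∪ e ⁻¹' V)
  rw [h3] at h4
  norm_num at h4

lemma reproducing_pull {V : Submodule ℂ C(K, ℂ)} {e : C(K, ℂ)} (heV : e ∈ V)
    (he : ∀ f ∈ V, ip μ e f = f 1) {γ : ↥(ContAut K)} (hγ : PullInv γ (V : Set C(K, ℂ)))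
    (hγ' : PullInv γ⁻¹ (V : Set C(K, ℂ))) : pull γ e = e := by
  refine eq_of_ip_eq μ (hγ e heV) heV fun v hv => ?_
  rw [← ip_conj, ← ip_conj μ e, ip_pull_left, he _ (hγ' v hv), he v hv]
  simp

lemma mem_bot_of_reproducing {V : Submodule ℂ C(K, ℂ)} (hV : IsRepr V) {e : C(K, ℂ)} (heV : e ∈ V)
    (he : ∀ f ∈ V, ip μ e f = f 1) (hconst : ∀ x y, e x = e y) {f : C(K, ℂ)} (hf : f ∈ V) :
    f ∈ (⊥ : StarSubalgebra ℂ C(K, ℂ)) := by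
  have := hV.fin
  have hconst : ∀ x b, translate x b e = e := fun x b => by
    ext y
    exact hconst _ _
  rw [StarSubalgebra.mem_bot]
  refine ⟨f 1, ?_⟩
  ext x
  have h1 := proj_apply μ hV.biInv heV he f x
  rw [proj_eq_self μ V hf] at h1
  rw [h1, ← inv_inv x, ← inv_one, ← ip_translate_left, hconst, he f hf]
  simp

lemma ErgSet.finAlg_eq_bot {μ : Measure K} [μ.IsHaarMeasure] [IsProbabilityMeasure μ]
    {Γ : Subgroup ↥(ContAut K)} (h : ErgSet μ (Γ : Set ↥(ContAut K))) : finAlg Γ = ⊥ := by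
  rw [eq_bot_iff]
  intro f hf
  obtain ⟨V, hV, hS, hf⟩ := mem_finAlg.1 hf
  have := hV.fin
  obtain ⟨e, heV, he⟩ := exists_reproducing μ V
  exact mem_bot_of_reproducing μ hV heV he (h.apply_eq fun γ hγ =>
    reproducing_pull μ heV he (hS γ hγ) (hS _ (Γ.inv_mem hγ))) hf

end Ergodic

section Chain

variable {K : Type*} [Group K] [TopologicalSpace K] [IsTopologicalGroup K] [CompactSpace K]

/-- The subgroup of elements acting trivially on the functions in `A`. -/
def trivialOn (A : StarSubalgebra ℂ C(K, ℂ)) : Subgroup K where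
  carrier := {x | ∀ f ∈ A, ∀ a b, f (a * x * b) = f (a * b)}
  one_mem' := by simp
  mul_mem' := by
    intro x y hx hy f hf a b
    rw [← mul_assoc, hy f hf, hx f hf]
  inv_mem' := by
    intro x hx f hf a b
    have := hx f hf (a * x⁻¹) b
    rw [inv_mul_cancel_right] at this
    exact this.symm

lemma mem_trivialOn {A : StarSubalgebra ℂ C(K, ℂ)} {x : K} :
    x ∈ trivialOn A ↔ ∀ f ∈ A, ∀ a b, f (a * x * b) = f (a * b) := Iff.rfl

lemma trivialOn_anti {A B : StarSubalgebra ℂ C(K, ℂ)} (h : A ≤ B) :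
    trivialOn B ≤ trivialOn A := fun _ hx f hf => hx f (h hf)

lemma isClosed_trivialOn (A : StarSubalgebra ℂ C(K, ℂ)) : IsClosed (trivialOn A : Set K) := by
  have : (trivialOn A : Set K) = ⋂ f ∈ A, ⋂ a, ⋂ b, {x : K | f (a * x * b) = f (a * b)} := by
    ext x
    simp [mem_trivialOn]
  rw [this]
  exact isClosed_biInter fun f _ => isClosed_iInter fun a => isClosed_iInter fun b =>
    isClosed_eq (by fun_prop) continuous_const

lemma apply_mem_trivialOn {A : StarSubalgebra ℂ C(K, ℂ)} {β : ↥(ContAut K)}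
    (hβ : PullInv β (A : Set C(K, ℂ))) {x : K} (hx : x ∈ trivialOn A) :
    (β : MulAut K) x ∈ trivialOn A := by
  intro f hf a b
  have := hx (pull β f) (hβ f hf) ((β : MulAut K)⁻¹ a) ((β : MulAut K)⁻¹ b)
  simpa using this

/-- A translation-invariant algebra of representative functions, invariant under `Z`. -/
structure Good (Z : Subgroup ↥(ContAut K)) (A : StarSubalgebra ℂ C(K, ℂ)) : Prop where
  le_finAlg : A ≤ finAlg ⊥
  biInv : BiInv (A : Set C(K, ℂ))
  pullInv : ∀ β ∈ Z, PullInv β (A : Set C(K, ℂ))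

lemma good_bot (Z : Subgroup ↥(ContAut K)) : Good Z ⊥ := by
  refine ⟨bot_le, fun a b f hf => ?_, fun β _ f hf => ?_⟩ <;>
  · rw [SetLike.mem_coe, StarSubalgebra.mem_bot] at hf ⊢
    obtain ⟨c, rfl⟩ := hf
    exact ⟨c, (AlgHomClass.commutes _ c).symm⟩

lemma good_finAlg {Z S : Subgroup ↥(ContAut K)} (h : ∀ β ∈ Z, ∀ γ ∈ S, β * γ = γ * β) :
    Good Z (finAlg S) :=
  ⟨finAlg_anti bot_le, finAlg_biInv S, fun β hβ => finAlg_pullInv (h β hβ)⟩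

lemma biInv_sup {A B : StarSubalgebra ℂ C(K, ℂ)} (hA : BiInv (A : Set C(K, ℂ)))
    (hB : BiInv (B : Set C(K, ℂ))) : BiInv ((A ⊔ B : StarSubalgebra ℂ C(K, ℂ)) : Set C(K, ℂ)) := by
  intro a b
  have h : A ⊔ B ≤ (A ⊔ B).comap (translate a b) :=
    sup_le (fun f hf => le_sup_left (a := A) (hA a b f hf))
      (fun f hf => le_sup_right (a := A) (hB a b f hf))
  exact h

lemma pullInv_sup {β : ↥(ContAut K)} {A B : StarSubalgebra ℂ C(K, ℂ)}
    (hA : PullInv β (A : Set C(K, ℂ))) (hB : PullInv β (B : Set C(K, ℂ))) :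
    PullInv β ((A ⊔ B : StarSubalgebra ℂ C(K, ℂ)) : Set C(K, ℂ)) := by
  have h : A ⊔ B ≤ (A ⊔ B).comap (pull β) :=
    sup_le (fun f hf => le_sup_left (a := A) (hA f hf))
      (fun f hf => le_sup_right (a := A) (hB f hf))
  exact h

lemma Good.sup {Z : Subgroup ↥(ContAut K)} {A B : StarSubalgebra ℂ C(K, ℂ)} (hA : Good Z A)
    (hB : Good Z B) : Good Z (A ⊔ B) :=
  ⟨sup_le hA.le_finAlg hB.le_finAlg, biInv_sup hA.biInv hB.biInv,
    fun β hβ => pullInv_sup (hA.pullInv β hβ) (hB.pullInv β hβ)⟩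

/-- Functions constant on the cosets of `trivialOn A` are limits of functions in `A`. -/
lemma mem_closure_of_trivialOn {A : StarSubalgebra ℂ C(K, ℂ)} (hA : BiInv (A : Set C(K, ℂ)))
    {f : C(K, ℂ)} (hf : ∀ x, ∀ c ∈ trivialOn A, f (x * c) = f x) :
    f ∈ closure (A : Set C(K, ℂ)) := by
  set C := trivialOn A with hC
  have hcl : IsClosed (C : Set K) := isClosed_trivialOn A
  let q : C(K, K ⧸ C) := ⟨QuotientGroup.mk, QuotientGroup.continuous_mk⟩
  let Q : C(K ⧸ C, ℂ) →⋆ₐ[ℂ] C(K, ℂ) := ContinuousMap.compStarAlgHom' ℂ ℂ q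
  have hlift : ∀ g : C(K, ℂ), (∀ x, ∀ c ∈ C, g (x * c) = g x) → ∃ g' : C(K ⧸ C, ℂ), Q g' = g := by
    intro g hg
    have hwd : ∀ x y : K, (QuotientGroup.leftRel C) x y → g x = g y := by
      intro x y hxy
      rw [QuotientGroup.leftRel_apply] at hxy
      have := hg x _ hxy
      rw [mul_inv_cancel_left] at this
      exact this.symm
    refine ⟨⟨Quotient.lift g hwd, Continuous.quotient_lift g.continuous hwd⟩, ?_⟩
    ext x
    rfl
  have hdense : (A.comap Q).topologicalClosure = ⊤ := by
    apply ContinuousMap.starSubalgebra_topologicalClosure_eq_top_of_separatesPoints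
    intro x y hxy
    induction x using QuotientGroup.induction_on with | _ x
    induction y using QuotientGroup.induction_on with | _ y
    have hne : y⁻¹ * x ∉ C := fun h => hxy (QuotientGroup.eq.2 h).symm
    rw [hC, mem_trivialOn] at hne
    push Not at hne
    obtain ⟨g, hg, a, b, hab⟩ := hne
    obtain ⟨g', hg'⟩ := hlift (translate (a * y⁻¹) b g) (fun z c hc => by
      have := hc g hg (a * y⁻¹ * z) b
      simpa [mul_assoc] using this)
    refine ⟨g', ⟨g', ?_, rfl⟩, ?_⟩
    · change Q g' ∈ A
      rw [hg']
      exact hA _ _ _ hg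
    · have h1 : ∀ z : K, g' (z : K ⧸ C) = translate (a * y⁻¹) b g z := fun z => by rw [← hg']; rfl
      rw [h1, h1]
      simpa [mul_assoc] using hab
  obtain ⟨f', rfl⟩ := hlift f hf
  have hf' : f' ∈ (A.comap Q).topologicalClosure := hdense ▸ StarSubalgebra.mem_top
  have hf' : f' ∈ closure (A.comap Q : Set C(K ⧸ C, ℂ)) := hf'
  have hQ : Continuous Q := ContinuousMap.continuous_precomp q
  exact map_mem_closure hQ hf' fun g hg => hg

variable [MeasurableSpace K] [BorelSpace K] (μ : Measure K) [μ.IsHaarMeasure]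
  [IsProbabilityMeasure μ]

lemma proj_mem_subalgebra {V : Submodule ℂ C(K, ℂ)} [FiniteDimensional ℂ V]
    (hV : BiInv (V : Set C(K, ℂ))) {A : StarSubalgebra ℂ C(K, ℂ)} (hA : A ≤ finAlg ⊥)
    (hA' : BiInv (A : Set C(K, ℂ))) {f : C(K, ℂ)} (hf : f ∈ A) : proj μ V f ∈ A := by
  obtain ⟨W, hW, -, hfW⟩ := mem_finAlg.1 (hA hf)
  have h := hW.inf (M := A.toSubmodule) hA'
  have := h.fin
  exact (proj_mem_of_mem μ hV h.biInv (f := f) ⟨hfW, hf⟩).2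

lemma le_of_trivialOn_le (μ : Measure K) [μ.IsHaarMeasure] [IsProbabilityMeasure μ]
    {A B : StarSubalgebra ℂ C(K, ℂ)} (hA : A ≤ finAlg ⊥)
    (hA' : BiInv (A : Set C(K, ℂ))) (hB : B ≤ finAlg ⊥) (h : trivialOn A ≤ trivialOn B) :
    B ≤ A := by
  intro f hf
  obtain ⟨V, hV, -, hfV⟩ := mem_finAlg.1 (hB hf)
  have := hV.fin
  have h1 : f ∈ closure (A : Set C(K, ℂ)) := mem_closure_of_trivialOn hA' fun x c hc => by
    simpa using h hc f hf x 1
  have h2 : FiniteDimensional ℂ ↥(V ⊓ A.toSubmodule) :=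
    Submodule.finiteDimensional_of_le inf_le_left
  have h3 : proj μ V f ∈ closure ((V ⊓ A.toSubmodule : Submodule ℂ C(K, ℂ)) : Set C(K, ℂ)) :=
    map_mem_closure (proj μ V).continuous h1 fun g hg =>
      ⟨proj_mem μ V g, proj_mem_subalgebra μ hV.biInv hA hA' hg⟩
  rw [(Submodule.closed_of_finiteDimensional (V ⊓ A.toSubmodule)).closure_eq,
    proj_eq_self μ V hfV] at h3
  exact h3.2

lemma HasDCC.wellFoundedGT (μ : Measure K) [μ.IsHaarMeasure] [IsProbabilityMeasure μ]
    {Z : Subgroup ↥(ContAut K)} (h : HasDCC (Z : Set ↥(ContAut K))) :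
    WellFoundedGT {A : StarSubalgebra ℂ C(K, ℂ) // Good Z A} := by
  rw [wellFoundedGT_iff_monotone_chain_condition]
  intro A
  obtain ⟨N, hN⟩ := h (fun n => trivialOn (A n).1) (fun n => isClosed_trivialOn _)
    (fun n => trivialOn_anti (A.monotone n.le_succ)) fun n β hβ x =>
      ⟨apply_mem_trivialOn ((A n).2.pullInv β hβ), fun hx => by
        have := apply_mem_trivialOn ((A n).2.pullInv _ (Z.inv_mem hβ)) hx
        simpa using this⟩
  refine ⟨N, fun n hn => le_antisymm (A.monotone hn) ?_⟩
  exact le_of_trivialOn_le μ (A N).2.le_finAlg (A N).2.biInv (A n).2.le_finAlg (hN n hn).ge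

end Chain

lemma eq_zero_of_inner_eq_const {H : Type*} [NormedAddCommGroup H] [InnerProductSpace ℂ H]
    {e : H} {u : ℕ → H} {c r : ℂ} (hc : ∀ n, inner ℂ e (u n) = c)
    (hr : ∀ n, inner ℂ (u n) (u n) = r) (ho : ∀ m n, m ≠ n → inner ℂ (u m) (u n) = 0) :
    c = 0 := by
  by_contra hne
  have hbound : ∀ n : ℕ, (n : ℝ) * ‖c‖ ^ 2 ≤ ‖e‖ ^ 2 * ‖r‖ := by
    intro n
    rcases Nat.eq_zero_or_pos n with rfl | hn
    · simp; positivity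
    have hn' : (0 : ℝ) < n := by exact_mod_cast hn
    set v := ∑ i ∈ Finset.range n, u i with hv
    have h1 : inner ℂ e v = n * c := by
      rw [hv, inner_sum]
      simp [hc]
    have h2 : inner ℂ v v = n * r := by
      rw [hv, sum_inner]
      have : ∀ i ∈ Finset.range n, inner ℂ (u i) (∑ j ∈ Finset.range n, u j) = r := by
        intro i hi
        rw [inner_sum, Finset.sum_eq_single i (fun j _ hji => ho i j hji.symm)
          (fun h => absurd hi h), hr]
      rw [Finset.sum_congr rfl this]
      simp
    have h3 : ‖v‖ ^ 2 = n * ‖r‖ := by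
      have := congrArg norm h2
      rw [inner_self_eq_norm_sq_to_K, norm_mul] at this
      simpa using this
    have h4 := norm_inner_le_norm (𝕜 := ℂ) e v
    rw [h1, norm_mul, Complex.norm_natCast] at h4
    have h5 : (n * ‖c‖) ^ 2 ≤ ‖e‖ ^ 2 * (n * ‖r‖) := by
      rw [← h3, ← mul_pow]
      gcongr
    have h6 : n * (n * ‖c‖ ^ 2) ≤ n * (‖e‖ ^ 2 * ‖r‖) := by nlinarith
    exact le_of_mul_le_mul_left h6 hn'
  have hpos : 0 < ‖c‖ ^ 2 := by positivity
  obtain ⟨n, hn⟩ := exists_nat_gt (‖e‖ ^ 2 * ‖r‖ / ‖c‖ ^ 2)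
  rw [div_lt_iff₀ hpos] at hn
  exact absurd (hbound n) (not_le.2 hn)

section Product

variable {K : Type*} [Group K] [TopologicalSpace K] [IsTopologicalGroup K] [CompactSpace K]

lemma mem_bot_iff_forall_eq {f : C(K, ℂ)} :
    f ∈ (⊥ : StarSubalgebra ℂ C(K, ℂ)) ↔ ∀ x y, f x = f y := by
  rw [StarSubalgebra.mem_bot]
  constructor
  · rintro ⟨c, rfl⟩ x y
    rfl
  · intro h
    exact ⟨f 1, by ext x; exact h 1 x⟩

lemma mem_sup_subalgebra {A B : StarSubalgebra ℂ C(K, ℂ)} {f : C(K, ℂ)} (hf : f ∈ A ⊔ B)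
    (M : Submodule ℂ C(K, ℂ)) (h : ∀ a ∈ A, ∀ b ∈ B, a * b ∈ M) : f ∈ M := by
  have hmul := Subalgebra.mul_toSubmodule A.toSubalgebra B.toSubalgebra
  let P : StarSubalgebra ℂ C(K, ℂ) :=
    { A.toSubalgebra ⊔ B.toSubalgebra with
      star_mem' := by
        intro g hg
        have hg : g ∈ Subalgebra.toSubmodule A.toSubalgebra * Subalgebra.toSubmodule B.toSubalgebra :=
          hmul ▸ hg
        change star g ∈ Subalgebra.toSubmodule (A.toSubalgebra ⊔ B.toSubalgebra)
        rw [← hmul]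
        refine Submodule.mul_induction_on hg (fun a ha b hb => ?_) fun a b ha hb => ?_
        · rw [star_mul']
          exact Submodule.mul_mem_mul (A.star_mem' ha) (B.star_mem' hb)
        · rw [star_add]
          exact Submodule.add_mem _ ha hb }
  have hP : A ⊔ B ≤ P := sup_le
    (fun a ha => (le_sup_left : A.toSubalgebra ≤ A.toSubalgebra ⊔ B.toSubalgebra) ha)
    (fun a ha => (le_sup_right : B.toSubalgebra ≤ A.toSubalgebra ⊔ B.toSubalgebra) ha)
  have h1 : f ∈ Subalgebra.toSubmodule (A.toSubalgebra ⊔ B.toSubalgebra) := hP hf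
  rw [← hmul] at h1
  exact Submodule.mul_le.2 h h1

lemma Irred.map_pull_injective {U : Submodule ℂ C(K, ℂ)} (hU : Irred U)
    {γ : ↥(ContAut K)} (h : ¬ ∀ f ∈ U, f ∈ finAlg (Subgroup.zpowers γ)) {i j : ℤ} (hij : i ≠ j) :
    U.map (pullₗ (γ ^ i)) ≠ U.map (pullₗ (γ ^ j)) := by
  wlog hlt : i < j generalizing i j
  · exact (this hij.symm (lt_of_le_of_ne (not_lt.1 hlt) hij.symm)).symm
  intro heq
  apply h
  intro f hf
  have hk : 0 < (j - i).toNat := by omega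
  refine mem_finAlg_of_pow hk (mem_finAlg'.2 ⟨U, hU.repr, ?_, hf⟩)
  rw [Subgroup.zpowers_le, mem_pullStab, ← zpow_natCast, Int.toNat_of_nonneg (by omega), zpow_sub,
    ← map_pull_map_pull, ← heq, map_pull_map_pull, mul_inv_cancel, map_pull_one]

variable [MeasurableSpace K] [BorelSpace K] (μ : Measure K) [μ.IsHaarMeasure]
  [IsProbabilityMeasure μ]

lemma Irred.ip_pull_eq_zero {U : Submodule ℂ C(K, ℂ)} (hU : Irred U)
    {γ : ↥(ContAut K)} (h : ¬ ∀ f ∈ U, f ∈ finAlg (Subgroup.zpowers γ)) {i j : ℤ} (hij : i ≠ j)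
    {f g : C(K, ℂ)} (hf : f ∈ U) (hg : g ∈ U) : ip μ (pull (γ ^ i) f) (pull (γ ^ j) g) = 0 :=
  (hU.map_pull _).ip_eq_zero μ (hU.map_pull _) (hU.map_pull_injective h hij) (pull_mem_map hf)
    (pull_mem_map hg)

/-- Algebras of representative functions with trivial intersection are independent. -/
lemma integral_mul_of_inf_eq_bot {A B : StarSubalgebra ℂ C(K, ℂ)} (hA : A ≤ finAlg ⊥)
    (hA' : BiInv (A : Set C(K, ℂ))) (hB : B ≤ finAlg ⊥) (hB' : BiInv (B : Set C(K, ℂ)))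
    (hAB : A ⊓ B = ⊥) {f g : C(K, ℂ)} (hf : f ∈ A) (hg : g ∈ B) :
    ∫ x, (f * g) x ∂μ = (∫ x, f x ∂μ) * ∫ x, g x ∂μ := by
  obtain ⟨V, hV, -, hfV⟩ := mem_finAlg.1 (hA (star_mem hf))
  obtain ⟨W, hW, -, h1W⟩ := mem_finAlg.1 (hA (one_mem A))
  set M := (V ⊔ W) ⊓ A.toSubmodule with hM
  have hMr : IsRepr M := (hV.sup hW).inf hA'
  have := hMr.fin
  have h1 : (1 : C(K, ℂ)) ∈ M := ⟨Submodule.mem_sup_right h1W, one_mem A⟩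
  have hsf : star f ∈ A := star_mem hf
  have h2 : star f ∈ M := ⟨Submodule.mem_sup_left hfV, hsf⟩
  have hp : proj μ M g ∈ A ⊓ B :=
    ⟨(proj_mem μ M g).2, proj_mem_subalgebra μ hMr.biInv hB hB' hg⟩
  rw [hAB, StarSubalgebra.mem_bot] at hp
  obtain ⟨c, hc⟩ := hp
  have h3 := ip_proj μ M g h1
  have h4 := ip_proj μ M g h2
  rw [← hc, Algebra.algebraMap_eq_smul_one, ip_smul_right, ip_def, ip_def, star_star] at h4
  rw [← hc, Algebra.algebraMap_eq_smul_one, ip_smul_right, ip_one_left, ip_one_left] at h3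
  rw [← h4, ← h3]
  simp [mul_comm]

lemma ip_mul_of_inf_eq_bot {A B : StarSubalgebra ℂ C(K, ℂ)} (hA : A ≤ finAlg ⊥)
    (hA' : BiInv (A : Set C(K, ℂ))) (hB : B ≤ finAlg ⊥) (hB' : BiInv (B : Set C(K, ℂ)))
    (hAB : A ⊓ B = ⊥) {a a' b b' : C(K, ℂ)} (ha : a ∈ A) (ha' : a' ∈ A) (hb : b ∈ B)
    (hb' : b' ∈ B) : ip μ (a * b) (a' * b') = ip μ a a' * ip μ b b' := by
  rw [ip_def, ip_def, ip_def, ← integral_mul_of_inf_eq_bot μ hA hA' hB hB' hAB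
    (mul_mem (star_mem ha) ha') (mul_mem (star_mem hb) hb')]
  congr 1
  funext x
  simp
  ring

lemma good_zpow_mem {Z : Subgroup ↥(ContAut K)} {A : StarSubalgebra ℂ C(K, ℂ)} (hA : Good Z A)
    {γ : ↥(ContAut K)} (hγ : γ ∈ Z) (n : ℤ) {f : C(K, ℂ)} (hf : f ∈ A) : pull (γ ^ n) f ∈ A :=
  hA.pullInv _ (Z.zpow_mem hγ n) f hf

lemma mem_of_irred_mem (μ : Measure K) [μ.IsHaarMeasure] [IsProbabilityMeasure μ]
    {A : StarSubalgebra ℂ C(K, ℂ)} (hA : A ≤ finAlg ⊥)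
    (hA' : BiInv (A : Set C(K, ℂ))) (M : Submodule ℂ C(K, ℂ))
    (h : ∀ U, Irred U → (∀ u ∈ U, u ∈ A) → U ≤ M) {f : C(K, ℂ)} (hf : f ∈ A) : f ∈ M := by
  obtain ⟨V, hV, -, hfV⟩ := mem_finAlg.1 (hA hf)
  exact le_of_irred_le μ (hV.inf (M := A.toSubmodule) hA') M
    (fun U hU hUi => h U hUi fun u hu => (hU hu).2) ⟨hfV, hf⟩

lemma finAlg_inf_sup_eq_bot (μ : Measure K) [μ.IsHaarMeasure] [IsProbabilityMeasure μ]
    {Z : Subgroup ↥(ContAut K)} {A B : StarSubalgebra ℂ C(K, ℂ)}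
    (hA : Good Z A) (hB : Good Z B) {γ : ↥(ContAut K)} (hγ : γ ∈ Z)
    (hγA : finAlg (Subgroup.zpowers γ) ⊓ A = ⊥) (hγB : finAlg (Subgroup.zpowers γ) ⊓ B = ⊥)
    (hAB : A ⊓ B = ⊥) : finAlg (Subgroup.zpowers γ) ⊓ (A ⊔ B) = ⊥ := by
  rw [eq_bot_iff]
  rintro f ⟨hf, hfAB⟩
  obtain ⟨V, hV, hVγ, hfV⟩ := mem_finAlg.1 hf
  have hAB' := hA.sup hB
  have hr := hV.inf (M := (A ⊔ B).toSubmodule) hAB'.biInv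
  have hr' := hr.fin
  obtain ⟨e, heV, he⟩ := exists_reproducing μ (V ⊓ (A ⊔ B).toSubmodule)
  have hinv : ∀ δ ∈ Subgroup.zpowers γ,
      PullInv δ ((V ⊓ (A ⊔ B).toSubmodule : Submodule ℂ C(K, ℂ)) : Set C(K, ℂ)) := by
    intro δ hδ g hg
    have hδZ : δ ∈ Z := (Subgroup.zpowers_le.2 hγ) hδ
    exact ⟨hVγ δ hδ g hg.1, hAB'.pullInv δ hδZ g hg.2⟩
  have heγ : ∀ n : ℤ, pull (γ ^ n) e = e := fun n =>
    reproducing_pull μ heV he (hinv _ (Subgroup.zpow_mem_zpowers γ n))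
      (hinv _ (Subgroup.inv_mem _ (Subgroup.zpow_mem_zpowers γ n)))
  refine mem_bot_of_reproducing μ hr heV he ?_ ⟨hfV, hfAB⟩
  rw [← mem_bot_iff_forall_eq]
  set c : C(K, ℂ) := algebraMap ℂ C(K, ℂ) (∫ x, e x ∂μ) with hc
  have hcm : ∀ D : StarSubalgebra ℂ C(K, ℂ), c ∈ D := fun D => algebraMap_mem D _
  suffices e - c = 0 by
    rw [sub_eq_zero] at this
    rw [this]
    exact hcm _
  apply eq_zero_of_ip_self μ
  have hpull : ∀ n : ℤ, pull (γ ^ n) (e - c) = e - c := fun n => by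
    rw [map_sub, heγ, hc, AlgHomClass.commutes]
  have hone : ip μ (e - c) 1 = 0 := by
    apply ip_comm_zero
    rw [ip_sub_right, ip_one_left, ip_one_left]
    simp [hc]
  let N : Submodule ℂ C(K, ℂ) := LinearMap.ker (innerSL ℂ (toL2 μ (e - c)) ∘L toL2 μ).toLinearMap
  have hN : ∀ g, g ∈ N ↔ ip μ (e - c) g = 0 := fun g => Iff.rfl
  rw [← hN]
  refine mem_sup_subalgebra (sub_mem heV.2 (hcm (A ⊔ B))) N fun a ha b hb => ?_
  refine mem_of_irred_mem μ hA.le_finAlg hA.biInv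
    (N.comap (LinearMap.mulRight ℂ b)) (fun U hU hUA a ha => ?_) ha
  refine mem_of_irred_mem μ hB.le_finAlg hB.biInv
    (N.comap (LinearMap.mulLeft ℂ a)) (fun U' hU' hUB b hb => ?_) hb
  change a * b ∈ N
  rw [hN]
  by_cases h1 : (∀ f ∈ U, f ∈ finAlg (Subgroup.zpowers γ)) ∧
      ∀ f ∈ U', f ∈ finAlg (Subgroup.zpowers γ)
  · have ha' : a ∈ finAlg (Subgroup.zpowers γ) ⊓ A := ⟨h1.1 a ha, hUA a ha⟩
    have hb' : b ∈ finAlg (Subgroup.zpowers γ) ⊓ B := ⟨h1.2 b hb, hUB b hb⟩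
    rw [hγA] at ha'
    rw [hγB] at hb'
    obtain ⟨d, hd⟩ := StarSubalgebra.mem_bot.1 (mul_mem ha' hb')
    rw [← hd, Algebra.algebraMap_eq_smul_one, ip_smul_right, hone, mul_zero]
  · have hip : ∀ m n : ℤ, ip μ (pull (γ ^ m) (a * b)) (pull (γ ^ n) (a * b)) =
        ip μ (pull (γ ^ m) a) (pull (γ ^ n) a) * ip μ (pull (γ ^ m) b) (pull (γ ^ n) b) := by
      intro m n
      rw [map_mul, map_mul]
      exact ip_mul_of_inf_eq_bot μ hA.le_finAlg hA.biInv hB.le_finAlg hB.biInv hAB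
        (good_zpow_mem hA hγ _ (hUA a ha)) (good_zpow_mem hA hγ _ (hUA a ha))
        (good_zpow_mem hB hγ _ (hUB b hb)) (good_zpow_mem hB hγ _ (hUB b hb))
    refine eq_zero_of_inner_eq_const (e := toL2 μ (e - c))
      (u := fun n : ℕ => toL2 μ (pull (γ ^ (n : ℤ)) (a * b))) (r := ip μ (a * b) (a * b))
      (fun n => ?_) (fun n => ip_pull μ _ _ _) (fun m n hmn => ?_)
    · change ip μ (e - c) _ = _
      rw [← hpull n, ip_pull, hpull]
    · change ip μ _ _ = 0
      have hmn' : (m : ℤ) ≠ n := by exact_mod_cast hmn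
      rw [hip]
      by_cases h2 : ∀ f ∈ U, f ∈ finAlg (Subgroup.zpowers γ)
      · rw [hU'.ip_pull_eq_zero μ (fun h3 => h1 ⟨h2, h3⟩) hmn' hb hb, mul_zero]
      · rw [hU.ip_pull_eq_zero μ h2 hmn' ha ha, zero_mul]

end Product

lemma wellFoundedGT_subgroup {G : Type*} [CommGroup G] [Group.FG G] :
    WellFoundedGT (Subgroup G) := by
  have hfin : Module.Finite ℤ (Additive G) := Module.Finite.iff_addGroup_fg.2 inferInstance
  have : IsNoetherian ℤ (Additive G) := inferInstance
  have h : WellFoundedGT (Submodule ℤ (Additive G)) := inferInstance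
  let φ : Subgroup G ≃o Submodule ℤ (Additive G) :=
    Subgroup.toAddSubgroup.trans AddSubgroup.toIntSubmodule
  exact φ.strictMono.wellFoundedGT

/-- A subgroup containing every element one of whose positive powers it contains. -/
def Isolated {G : Type*} [Group G] (S : Subgroup G) : Prop :=
  ∀ g : G, ∀ k : ℕ, 0 < k → g ^ k ∈ S → g ∈ S

open scoped Pointwise in
lemma exists_notMem_of_isolated {G : Type*} [Group G] (𝒰 : Finset (Subgroup G))
    (h : ∀ S ∈ 𝒰, Isolated S ∧ S ≠ ⊤) : ∃ g : G, ∀ S ∈ 𝒰, g ∉ S := by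
  by_contra! hcon
  have hcov : ⋃ S ∈ 𝒰, (1 : G) • ((S : Subgroup G) : Set G) = Set.univ := by
    refine Set.eq_univ_of_forall fun g => ?_
    obtain ⟨S, hS, hg⟩ := hcon g
    exact mem_iUnion₂.2 ⟨S, hS, by simpa using hg⟩
  obtain ⟨S, hS, hfin⟩ := Subgroup.exists_finiteIndex_of_leftCoset_cover
    (H := fun S : Subgroup G => S) (g := fun _ => 1) hcov
  apply (h S hS).2
  rw [Subgroup.eq_top_iff']
  intro g
  obtain ⟨k, hk, -, hmem⟩ := Subgroup.exists_pow_mem_of_index_ne_zero hfin.index_ne_zero g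
  exact (h S hS).1 g k hk hmem

section Existence

variable {K : Type*} [Group K] [TopologicalSpace K] [IsTopologicalGroup K] [CompactSpace K]
  [MeasurableSpace K] [BorelSpace K]

theorem exists_finAlg_eq_bot (μ : Measure K) [μ.IsHaarMeasure] [IsProbabilityMeasure μ]
    {Γ Z : Subgroup ↥(ContAut K)} (hZ : ∀ β, β ∈ Z ↔ ∀ γ ∈ Γ, β * γ = γ * β)
    (hΓ : ∀ γ ∈ Γ, ∀ δ ∈ Γ, γ * δ = δ * γ) [WellFoundedGT (Subgroup ↥Γ)]
    [WellFoundedGT {A : StarSubalgebra ℂ C(K, ℂ) // Good Z A}] (hbot : finAlg Γ = ⊥) :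
    ∃ γ ∈ Γ, finAlg (Subgroup.zpowers γ) = ⊥ := by
  let 𝒢 : Set {A : StarSubalgebra ℂ C(K, ℂ) // Good Z A} :=
    {A | ∃ 𝒰 : Finset (Subgroup ↥Γ), (∀ S ∈ 𝒰, Isolated S ∧ S ≠ ⊤) ∧
      ∀ δ : ↥Γ, finAlg (Subgroup.zpowers (δ : ↥(ContAut K))) ⊓ A.1 ≠ ⊥ → ∃ S ∈ 𝒰, δ ∈ S}
  have hne : 𝒢.Nonempty :=
    ⟨⟨⊥, good_bot Z⟩, ∅, by simp, fun δ hδ => absurd (inf_bot_eq _) hδ⟩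
  obtain ⟨B, ⟨𝒰, h𝒰, hB⟩, hmax⟩ := WellFounded.has_min (wellFounded_gt (α := {A // Good Z A})) 𝒢 hne
  obtain ⟨γ, hγ⟩ := exists_notMem_of_isolated 𝒰 h𝒰
  refine ⟨γ, γ.2, ?_⟩
  by_contra hcon
  have hγB : finAlg (Subgroup.zpowers (γ : ↥(ContAut K))) ⊓ B.1 = ⊥ := by
    by_contra hc
    obtain ⟨S, hS, hγS⟩ := hB γ hc
    exact hγ S hS hγS
  let 𝒮 : Set (Subgroup ↥Γ) := {T | γ ∈ T ∧ finAlg (T.map Γ.subtype) ≠ ⊥}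
  have hne' : 𝒮.Nonempty := by
    refine ⟨Subgroup.zpowers γ, Subgroup.mem_zpowers γ, ?_⟩
    rw [MonoidHom.map_zpowers]
    exact hcon
  obtain ⟨S, ⟨hγS, hSne⟩, hSmax⟩ := WellFounded.has_min (wellFounded_gt (α := Subgroup ↥Γ)) 𝒮 hne'
  have hSΓ : ∀ s ∈ S.map Γ.subtype, s ∈ Γ := fun s hs => Subgroup.map_subtype_le S hs
  have hA : Good Z (finAlg (S.map Γ.subtype)) :=
    good_finAlg fun β hβ s hs => (hZ β).1 hβ s (hSΓ s hs)
  have hbad : ∀ f ∈ finAlg (S.map Γ.subtype), f ∉ (⊥ : StarSubalgebra ℂ C(K, ℂ)) → ∀ δ : ↥Γ,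
      f ∈ finAlg (Subgroup.zpowers (δ : ↥(ContAut K))) → δ ∈ S := by
    intro f hf hf0 δ hδ
    have h1 := mem_finAlg_sup (fun s hs => hΓ δ δ.2 s (hSΓ s hs)) hf hδ
    have h2 : S ⊔ Subgroup.zpowers δ ∈ 𝒮 := by
      refine ⟨Subgroup.mem_sup_left hγS, fun h0 => hf0 ?_⟩
      rw [← h0, Subgroup.map_sup, MonoidHom.map_zpowers]
      exact h1
    by_contra hδS
    refine hSmax _ h2 (lt_of_le_of_ne le_sup_left fun heq => hδS ?_)
    rw [heq]
    exact Subgroup.mem_sup_right (Subgroup.mem_zpowers δ)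
  obtain ⟨f, hf, hf0⟩ : ∃ f ∈ finAlg (S.map Γ.subtype), f ∉ (⊥ : StarSubalgebra ℂ C(K, ℂ)) := by
    by_contra! hc
    exact hSne (eq_bot_iff.2 hc)
  have hiso : Isolated S := by
    intro δ k hk hδ
    refine hbad f hf hf0 δ (mem_finAlg_of_pow hk (finAlg_anti ?_ hf))
    rw [Subgroup.zpowers_le]
    exact ⟨δ ^ k, hδ, by simp⟩
  have htop : S ≠ ⊤ := by
    rintro rfl
    apply hSne
    rw [← MonoidHom.range_eq_map, Subgroup.range_subtype, hbot]
  have hγle : finAlg (S.map Γ.subtype) ≤ finAlg (Subgroup.zpowers (γ : ↥(ContAut K))) :=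
    finAlg_anti (Subgroup.zpowers_le.2 ⟨γ, hγS, rfl⟩)
  have hAB : finAlg (S.map Γ.subtype) ⊓ B.1 = ⊥ := by
    rw [eq_bot_iff, ← hγB]
    exact inf_le_inf_right _ hγle
  have hABmem : (⟨_, hA.sup B.2⟩ : {A : StarSubalgebra ℂ C(K, ℂ) // Good Z A}) ∈ 𝒢 := by
    classical
    refine ⟨insert S 𝒰, ?_, fun δ hδ => ?_⟩
    · intro T hT
      rcases Finset.mem_insert.1 hT with rfl | hT
      · exact ⟨hiso, htop⟩
      · exact h𝒰 T hT
    · by_contra! hc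
      apply hδ
      have hδZ : (δ : ↥(ContAut K)) ∈ Z := (hZ _).2 fun γ hγ => hΓ δ δ.2 γ hγ
      refine finAlg_inf_sup_eq_bot μ hA B.2 hδZ ?_ ?_ hAB
      · rw [eq_bot_iff]
        rintro g ⟨hg1, hg2⟩
        by_contra hg0
        exact hc S (Finset.mem_insert_self _ _) (hbad g hg2 hg0 δ hg1)
      · by_contra h0
        obtain ⟨T, hT, hδT⟩ := hB δ h0
        exact hc T (Finset.mem_insert_of_mem hT) hδT
  have hle : finAlg (S.map Γ.subtype) ≤ B.1 := by
    have h1 := hmax _ hABmem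
    have h2 : B.1 ≤ finAlg (S.map Γ.subtype) ⊔ B.1 := le_sup_right
    have h3 : B.1 = finAlg (S.map Γ.subtype) ⊔ B.1 := by
      by_contra hn
      exact h1 (lt_of_le_of_ne (α := {A : StarSubalgebra ℂ C(K, ℂ) // Good Z A}) h2
        fun heq => hn (congrArg Subtype.val heq))
    exact h3 ▸ le_sup_left
  apply hSne
  rw [← hAB, inf_eq_left.2 hle]

end Existence

/-- The filter of integer tuples whose entries are far apart. -/
def gapFilter (ι : Type*) : Filter (ι → ℤ) := ⨅ N : ℕ, Filter.principal {n | Gap N n}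

lemma hasBasis_gapFilter (ι : Type*) :
    (gapFilter ι).HasBasis (fun _ : ℕ => True) fun N => {n | Gap N n} :=
  Filter.hasBasis_iInf_principal (directed_of_isDirected_le fun _ _ h _ hn => Gap.mono hn h)

lemma eventually_gapFilter {ι : Type*} {p : (ι → ℤ) → Prop} :
    (∀ᶠ n in gapFilter ι, p n) ↔ ∃ N : ℕ, ∀ n, Gap N n → p n := by
  rw [(hasBasis_gapFilter ι).eventually_iff]
  simp

/-- The vectors on which an equibounded family of functionals tends to zero form a closed
subspace. -/
lemma isClosed_setOf_tendsto_zero {α E : Type*} [NormedAddCommGroup E] {l : Filter α}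
    {Λ : α → E → ℂ} (hsub : ∀ a x y, Λ a (x - y) = Λ a x - Λ a y) {C : ℝ}
    (hC : ∀ a x, ‖Λ a x‖ ≤ C * ‖x‖) :
    IsClosed {x | Filter.Tendsto (fun a => Λ a x) l (𝓝 0)} := by
  rw [← closure_subset_iff_isClosed]
  intro x hx
  rw [mem_ofPred_eq, Metric.tendsto_nhds]
  intro ε hε
  have hC' : 0 < |C| + 1 := by positivity
  obtain ⟨y, hy, hxy⟩ := Metric.mem_closure_iff.1 hx (ε / 2 / (|C| + 1)) (by positivity)
  filter_upwards [Metric.tendsto_nhds.1 hy (ε / 2) (by positivity)] with a ha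
  rw [dist_zero_right] at ha ⊢
  have h1 : Λ a x = Λ a (x - y) + Λ a y := by rw [hsub]; ring
  have h2 : ‖Λ a (x - y)‖ < ε / 2 := by
    rw [dist_eq_norm, lt_div_iff₀ hC'] at hxy
    calc ‖Λ a (x - y)‖ ≤ C * ‖x - y‖ := hC a _
      _ ≤ (|C| + 1) * ‖x - y‖ := by
        gcongr
        linarith [le_abs_self C]
      _ < ε / 2 := by rw [mul_comm]; exact hxy
  rw [h1]
  exact (norm_add_le _ _).trans_lt (by linarith)

section Mix

variable {K : Type*} [Group K] [TopologicalSpace K] [IsTopologicalGroup K] [CompactSpace K]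

/-- The product of the functions `f i ∘ γ ^ n i`. -/
noncomputable def prodPull {ι : Type*} [Fintype ι] (γ : ↥(ContAut K)) (f : ι → C(K, ℂ))
    (n : ι → ℤ) : C(K, ℂ) := ∏ i, pull (γ ^ n i) (f i)

lemma prodPull_update {ι : Type*} [Fintype ι] [DecidableEq ι] (γ : ↥(ContAut K))
    (f : ι → C(K, ℂ)) (i : ι) (g : C(K, ℂ)) (n : ι → ℤ) :
    prodPull γ (Function.update f i g) n =
      pull (γ ^ n i) g * ∏ j ∈ Finset.univ.erase i, pull (γ ^ n j) (f j) := by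
  rw [prodPull, ← Finset.mul_prod_erase _ _ (Finset.mem_univ i), Function.update_self]
  congr 1
  refine Finset.prod_congr rfl fun j hj => ?_
  rw [Function.update_of_ne (Finset.ne_of_mem_erase hj)]

lemma norm_pull_le (γ : ↥(ContAut K)) (f : C(K, ℂ)) : ‖pull γ f‖ ≤ ‖f‖ :=
  (ContinuousMap.norm_le _ (norm_nonneg f)).2 fun _ => ContinuousMap.norm_coe_le_norm f _

variable [MeasurableSpace K] [BorelSpace K] (μ : Measure K) [μ.IsHaarMeasure]
  [IsProbabilityMeasure μ]

lemma norm_integral_le (f : C(K, ℂ)) : ‖∫ x, f x ∂μ‖ ≤ ‖f‖ := by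
  have := norm_integral_le_of_norm_le_const (μ := μ) (f := f) (C := ‖f‖)
    (.of_forall fun x => ContinuousMap.norm_coe_le_norm f x)
  simpa using this

lemma integral_sub_continuousMap (f g : C(K, ℂ)) :
    ∫ x, (f - g) x ∂μ = ∫ x, f x ∂μ - ∫ x, g x ∂μ :=
  integral_sub (integrable_continuousMap μ f) (integrable_continuousMap μ g)

lemma integral_add_continuousMap (f g : C(K, ℂ)) :
    ∫ x, (f + g) x ∂μ = ∫ x, f x ∂μ + ∫ x, g x ∂μ :=
  integral_add (integrable_continuousMap μ f) (integrable_continuousMap μ g)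

lemma integral_smul_continuousMap (c : ℂ) (f : C(K, ℂ)) :
    ∫ x, (c • f) x ∂μ = c * ∫ x, f x ∂μ := integral_const_mul c f

/-- The correlations of the functions `f i ∘ γ ^ n i` vanish asymptotically. -/
def Mix {ι : Type*} [Fintype ι] (γ : ↥(ContAut K)) (f : ι → C(K, ℂ)) : Prop :=
  Filter.Tendsto (fun n => ∫ x, prodPull γ f n x ∂μ) (gapFilter ι) (𝓝 (∏ i, ∫ x, f i x ∂μ))

variable {ι : Type*} [Fintype ι] [DecidableEq ι] (γ : ↥(ContAut K)) (f : ι → C(K, ℂ)) (i : ι)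

/-- The defect of mixing as a functional of the `i`-th function. -/
noncomputable def mixDefect (n : ι → ℤ) (g : C(K, ℂ)) : ℂ :=
  ∫ x, (pull (γ ^ n i) g * ∏ j ∈ Finset.univ.erase i, pull (γ ^ n j) (f j)) x ∂μ -
    (∫ x, g x ∂μ) * ∏ j ∈ Finset.univ.erase i, ∫ x, f j x ∂μ

lemma mix_update_iff (g : C(K, ℂ)) : Mix μ γ (Function.update f i g) ↔
    Filter.Tendsto (fun n => mixDefect μ γ f i n g) (gapFilter ι) (𝓝 0) := by
  have h : ∏ j, ∫ x, Function.update f i g j x ∂μ =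
      (∫ x, g x ∂μ) * ∏ j ∈ Finset.univ.erase i, ∫ x, f j x ∂μ := by
    rw [← Finset.mul_prod_erase _ _ (Finset.mem_univ i), Function.update_self]
    congr 1
    refine Finset.prod_congr rfl fun j hj => ?_
    rw [Function.update_of_ne (Finset.ne_of_mem_erase hj)]
  rw [Mix, h, ← tendsto_sub_nhds_zero_iff]
  simp_rw [prodPull_update]
  rfl

lemma mixDefect_add (n : ι → ℤ) (g h : C(K, ℂ)) :
    mixDefect μ γ f i n (g + h) = mixDefect μ γ f i n g + mixDefect μ γ f i n h := by
  simp only [mixDefect, map_add, add_mul, integral_add_continuousMap]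
  ring

lemma mixDefect_smul (n : ι → ℤ) (c : ℂ) (g : C(K, ℂ)) :
    mixDefect μ γ f i n (c • g) = c * mixDefect μ γ f i n g := by
  simp only [mixDefect, map_smul, smul_mul_assoc, integral_smul_continuousMap]
  ring

lemma norm_mixDefect_le (n : ι → ℤ) (g : C(K, ℂ)) : ‖mixDefect μ γ f i n g‖ ≤
    2 * (∏ j ∈ Finset.univ.erase i, ‖f j‖) * ‖g‖ := by
  have h1 : ‖∏ j ∈ Finset.univ.erase i, pull (γ ^ n j) (f j)‖ ≤
      ∏ j ∈ Finset.univ.erase i, ‖f j‖ :=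
    (Finset.norm_prod_le _ _).trans (Finset.prod_le_prod (fun _ _ => norm_nonneg _)
      fun j _ => norm_pull_le _ _)
  have h2 : ‖∏ j ∈ Finset.univ.erase i, ∫ x, f j x ∂μ‖ ≤ ∏ j ∈ Finset.univ.erase i, ‖f j‖ :=
    (Finset.norm_prod_le _ _).trans (Finset.prod_le_prod (fun _ _ => norm_nonneg _)
      fun j _ => norm_integral_le μ _)
  have h3 := norm_integral_le μ
    (pull (γ ^ n i) g * ∏ j ∈ Finset.univ.erase i, pull (γ ^ n j) (f j))
  have h4 : ‖pull (γ ^ n i) g * ∏ j ∈ Finset.univ.erase i, pull (γ ^ n j) (f j)‖ ≤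
      ‖g‖ * ∏ j ∈ Finset.univ.erase i, ‖f j‖ :=
    (norm_mul_le _ _).trans (mul_le_mul (norm_pull_le _ _) h1 (norm_nonneg _) (norm_nonneg _))
  have h5 : ‖(∫ x, g x ∂μ) * ∏ j ∈ Finset.univ.erase i, ∫ x, f j x ∂μ‖ ≤
      ‖g‖ * ∏ j ∈ Finset.univ.erase i, ‖f j‖ :=
    (norm_mul_le _ _).trans (mul_le_mul (norm_integral_le μ g) h2 (norm_nonneg _) (norm_nonneg _))
  refine (norm_sub_le _ _).trans ?_
  linarith

/-- The functions `g` that can be put in position `i` of the family `f`. -/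
def mixSpace : Submodule ℂ C(K, ℂ) where
  carrier := {g | Mix μ γ (Function.update f i g)}
  add_mem' := by
    intro g h hg hh
    rw [mem_ofPred_eq, mix_update_iff] at hg hh ⊢
    simp_rw [mixDefect_add]
    simpa using hg.add hh
  zero_mem' := by
    rw [mem_ofPred_eq, mix_update_iff]
    have : ∀ n, mixDefect μ γ f i n 0 = 0 := fun n => by
      simpa using mixDefect_smul μ γ f i n 0 0
    simp_rw [this]
    exact tendsto_const_nhds
  smul_mem' := by
    intro c g hg
    rw [mem_ofPred_eq, mix_update_iff] at hg ⊢
    simp_rw [mixDefect_smul]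
    simpa using hg.const_mul c

lemma mem_mixSpace {g : C(K, ℂ)} : g ∈ mixSpace μ γ f i ↔ Mix μ γ (Function.update f i g) := Iff.rfl

lemma mem_mixSpace_self : f i ∈ mixSpace μ γ f i ↔ Mix μ γ f := by
  rw [mem_mixSpace, Function.update_eq_self]

lemma isClosed_mixSpace : IsClosed (mixSpace μ γ f i : Set C(K, ℂ)) := by
  have : (mixSpace μ γ f i : Set C(K, ℂ)) = {g | Filter.Tendsto (fun n => mixDefect μ γ f i n g)
      (gapFilter ι) (𝓝 0)} := by
    ext g
    exact mix_update_iff μ γ f i g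
  rw [this]
  refine isClosed_setOf_tendsto_zero (fun n g h => ?_) (norm_mixDefect_le μ γ f i)
  rw [sub_eq_add_neg, mixDefect_add, ← neg_one_smul ℂ h, mixDefect_smul]
  ring

lemma mem_of_isClosed_of_irred [TopologicalSpace.MetrizableSpace K] (μ : Measure K)
    [μ.IsHaarMeasure] [IsProbabilityMeasure μ] {M : Submodule ℂ C(K, ℂ)}
    (hM : IsClosed (M : Set C(K, ℂ))) (h : ∀ U, Irred U → U ≤ M) (f : C(K, ℂ)) : f ∈ M := by
  have h1 : f ∈ (finAlg (⊥ : Subgroup ↥(ContAut K))).topologicalClosure :=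
    finAlg_bot_dense μ ▸ StarSubalgebra.mem_top
  have h2 : f ∈ closure (finAlg (⊥ : Subgroup ↥(ContAut K)) : Set C(K, ℂ)) := h1
  exact closure_minimal (fun g hg => mem_of_irred_mem μ le_rfl (finAlg_biInv _) M
    (fun U hU _ => h U hU) hg) hM h2

end Mix

section Commutators

open scoped commutatorElement

variable {K : Type*} [Group K] [TopologicalSpace K] [IsTopologicalGroup K] [CompactSpace K]

lemma exists_nhds_one_commutator {O : Set K} (hO : O ∈ 𝓝 (1 : K)) :
    ∃ P ∈ 𝓝 (1 : K), ∀ p ∈ P, ∀ y, ⁅p, y⁆ ∈ O ∧ ⁅y, p⁆ ∈ O := by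
  have h : ∀ᶠ p in 𝓝 (1 : K), ∀ y ∈ (univ : Set K), ⁅p, y⁆ ∈ O ∧ ⁅y, p⁆ ∈ O := by
    refine isCompact_univ.eventually_forall_of_forall_eventually fun y _ => ?_
    have h1 : Continuous fun z : K × K => ⁅z.1, z.2⁆ := by
      simp only [commutatorElement_def]
      fun_prop
    have h2 : Continuous fun z : K × K => ⁅z.2, z.1⁆ := by
      simp only [commutatorElement_def]
      fun_prop
    have h3 := h1.tendsto (1, y)
    have h4 := h2.tendsto (1, y)
    simp only [commutatorElement_one_left, commutatorElement_one_right] at h3 h4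
    exact (h3.eventually hO).and (h4.eventually hO)
  exact ⟨_, h, fun p hp y => hp y (mem_univ y)⟩

lemma exists_nhds_commutator {a b : K} {O : Set K} (hO : O ∈ 𝓝 ⁅a, b⁆) :
    ∃ A ∈ 𝓝 a, ∃ B ∈ 𝓝 b, ∀ x ∈ A, ∀ y ∈ B, ⁅x, y⁆ ∈ O := by
  have h1 : Continuous fun z : K × K => ⁅z.1, z.2⁆ := by
    simp only [commutatorElement_def]
    fun_prop
  obtain ⟨A, hA, B, hB, h⟩ := mem_nhds_prod_iff.1 ((h1.tendsto (a, b)).eventually hO)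
  exact ⟨A, hA, B, hB, fun x hx y hy => h (mk_mem_prod hx hy)⟩

variable [MeasurableSpace K] [BorelSpace K] (μ : Measure K) [μ.IsHaarMeasure]
  [IsProbabilityMeasure μ]
  {ι : Type*} [Fintype ι] [DecidableEq ι] (γ : ↥(ContAut K))

/-- Mixing for families of functions that are trivial outside of `s`. -/
def MixOn (s : Finset ι) : Prop := ∀ f : ι → C(K, ℂ), (∀ i ∉ s, f i = 1) → Mix μ γ f

variable {μ γ}

lemma MixOn.exists_mem [T2Space K] {t : Finset ι} (h : MixOn μ γ t) {p : ι → K} {O : ι → Set K}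
    (hO : ∀ i, O i ∈ 𝓝 (p i)) :
    ∀ᶠ n in gapFilter ι, ∃ z : K, ∀ i ∈ t, ((γ ^ n i : ↥(ContAut K)) : MulAut K) z ∈ O i := by
  have hb : ∀ i, ∃ f : C(K, ℂ), (∀ x, f x ≠ 0 → x ∈ O i) ∧ ∫ x, f x ∂μ ≠ 0 := by
    intro i
    obtain ⟨h, h0, h1, h2⟩ := exists_continuous_zero_one_of_isClosed
      (isOpen_interior (s := O i)).isClosed_compl (isClosed_singleton (x := p i))
      (by simpa [mem_interior_iff_mem_nhds] using hO i)
    refine ⟨⟨fun x => (h x : ℂ), by fun_prop⟩, fun x hx => ?_, ?_⟩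
    · by_contra hxO
      apply hx
      have : h x = 0 := h0 fun hxi => hxO (interior_subset hxi)
      simp [this]
    · have : 0 < ∫ x, h x ∂μ :=
        h.continuous.integral_pos_of_hasCompactSupport_nonneg_nonzero (x := p i)
          (.of_compactSpace _) (fun x => (h2 x).1) (by simp [h1 (mem_singleton _)])
      simp only [ContinuousMap.coe_mk, integral_complex_ofReal]
      exact_mod_cast this.ne'
  choose f hf hf' using hb
  have hm := h (fun i => if i ∈ t then f i else 1) fun i hi => if_neg hi
  have hne : ∏ i, ∫ x, (if i ∈ t then f i else 1 : C(K, ℂ)) x ∂μ ≠ 0 := by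
    refine Finset.prod_ne_zero_iff.2 fun i _ => ?_
    split_ifs
    · exact hf' i
    · simp
  filter_upwards [hm.eventually_ne hne] with n hn
  obtain ⟨z, hz⟩ : ∃ z, prodPull γ (fun i => if i ∈ t then f i else 1) n z ≠ 0 := by
    by_contra! hz
    exact hn (by simp [hz])
  refine ⟨z, fun i hi => hf i _ fun h0 => hz ?_⟩
  rw [prodPull, ContinuousMap.prod_apply]
  exact Finset.prod_eq_zero (Finset.mem_univ i) (by simpa [hi] using h0)

lemma translate_commutator_sub_mem_mixSpace [T2Space K] {s : Finset ι} {i₀ j k : ι} (hi₀ : i₀ ∈ s)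
    (hj : j ≠ i₀) (hk : k ≠ i₀) (hjk : j ≠ k) (hsj : MixOn μ γ (s.erase j))
    (hsk : MixOn μ γ (s.erase k)) {f : ι → C(K, ℂ)} (hf : ∀ i ∉ s, f i = 1) (g : C(K, ℂ)) (a b : K) :
    translate ⁅a, b⁆ 1 g - g ∈ mixSpace μ γ f i₀ := by
  rw [mem_mixSpace, mix_update_iff]
  set c := ⁅a, b⁆ with hc
  set f' := Function.update f i₀ g with hf'
  have hf1 : ∀ i ∉ s, f' i = 1 := by
    intro i hi
    have hne : i ≠ i₀ := fun h => hi (h ▸ hi₀)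
    rw [hf', Function.update_of_ne hne, hf i hi]
  let G : C(ι → K, ℂ) := ∏ i, (f' i).comp ⟨fun y => y i, by fun_prop⟩
  have hG : ∀ y, G y = ∏ i, f' i (y i) := fun y => by
    simp [G, ContinuousMap.prod_apply]
  let e : (ι → ℤ) → K → ι → K := fun n x i => ((γ ^ n i : ↥(ContAut K)) : MulAut K) x
  let v₀ : ι → K := Function.update 1 i₀ c
  have hd : ∀ n, mixDefect μ γ f i₀ n (translate c 1 g - g) =
      ∫ x, translate v₀ 1 G (e n x) ∂μ - ∫ x, G (e n x) ∂μ := by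
    intro n
    rw [mixDefect, integral_sub_continuousMap, integral_translate, sub_self, zero_mul, sub_zero,
      map_sub, sub_mul, integral_sub_continuousMap, ← prodPull_update, ← prodPull_update]
    congr 1
    · congr 1
      ext x
      rw [prodPull, ContinuousMap.prod_apply, translate_apply, hG]
      refine Finset.prod_congr rfl fun i _ => ?_
      by_cases hi : i = i₀
      · subst hi
        simp [v₀, e, f']
      · simp [v₀, e, f', hi]
    · congr 1
      ext x
      rw [prodPull, ContinuousMap.prod_apply, hG]
      rfl
  simp_rw [hd]
  rw [Metric.tendsto_nhds]
  intro ε hε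
  have hcont : Continuous fun v : ι → K => translate v 1 G :=
    (continuous_translate G).comp (by fun_prop : Continuous fun v : ι → K => (v, (1 : ι → K)))
  have hW := (Metric.tendsto_nhds.1 (hcont.tendsto v₀)) ε hε
  rw [nhds_pi, Filter.eventually_iff, Filter.mem_pi'] at hW
  obtain ⟨I, O, hO, hbox_sub⟩ := hW
  have hO₀ : O i₀ ∈ 𝓝 ⁅a, b⁆ := by simpa [v₀] using hO i₀
  obtain ⟨A, hA, B, hB, hAB⟩ := exists_nhds_commutator hO₀
  have hP : ∀ i, ∃ P ∈ 𝓝 (1 : K), i ≠ i₀ → ∀ p ∈ P, ∀ y, ⁅p, y⁆ ∈ O i ∧ ⁅y, p⁆ ∈ O i := by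
    intro i
    by_cases hi : i = i₀
    · exact ⟨univ, Filter.univ_mem, fun h => absurd hi h⟩
    · have : O i ∈ 𝓝 (1 : K) := by simpa [v₀, hi] using hO i
      obtain ⟨P, hP, h⟩ := exists_nhds_one_commutator this
      exact ⟨P, hP, fun _ => h⟩
  choose P hP hPO using hP
  have hz := hsj.exists_mem (p := Function.update 1 i₀ a) (O := Function.update P i₀ A) (by
    intro i
    by_cases hi : i = i₀
    · subst hi
      simpa using hA
    · simpa [hi] using hP i)
  have hz' := hsk.exists_mem (p := Function.update 1 i₀ b) (O := Function.update P i₀ B) (by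
    intro i
    by_cases hi : i = i₀
    · subst hi
      simpa using hB
    · simpa [hi] using hP i)
  filter_upwards [hz, hz'] with n ⟨z, hz⟩ ⟨z', hz'⟩
  let v : ι → K := fun i => if i ∈ s then e n ⁅z, z'⁆ i else 1
  have hvO : v ∈ (I : Set ι).pi O := by
    intro i _
    by_cases his : i ∈ s
    swap
    · have : O i ∈ 𝓝 (1 : K) := by
        have hi : i ≠ i₀ := fun h => his (h ▸ hi₀)
        simpa [v₀, hi] using hO i
      simpa [v, his] using mem_of_mem_nhds this
    · simp only [v, his, if_true, e, map_commutatorElement]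
      by_cases hi : i = i₀
      · subst hi
        refine hAB _ ?_ _ ?_
        · simpa using hz i (Finset.mem_erase.2 ⟨hj.symm, his⟩)
        · simpa using hz' i (Finset.mem_erase.2 ⟨hk.symm, his⟩)
      · by_cases hij : i = j
        · have := hz' i (Finset.mem_erase.2 ⟨fun h => hjk (hij.symm.trans h), his⟩)
          rw [Function.update_of_ne hi] at this
          exact (hPO i hi _ this _).2
        · have := hz i (Finset.mem_erase.2 ⟨hij, his⟩)
          rw [Function.update_of_ne hi] at this
          exact (hPO i hi _ this _).1
  have hv : dist (translate v 1 G) (translate v₀ 1 G) < ε := hbox_sub hvO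
  have hev : Continuous (e n) := continuous_pi fun i => ContAut.continuous _
  let E : C(K, ι → K) := ⟨e n, hev⟩
  have htr : ∫ x, G (e n x) ∂μ = ∫ x, translate v 1 G (e n x) ∂μ := by
    refine (integral_translate μ ⁅z, z'⁆ 1 (G.comp E)).symm.trans ?_
    congr 1
    ext x
    simp only [translate_apply, mul_one, ContinuousMap.comp_apply, hG]
    refine Finset.prod_congr rfl fun i _ => ?_
    by_cases his : i ∈ s
    · simp [v, his, E, e]
    · simp [hf1 i his]
  rw [dist_zero_right, htr]
  have := norm_integral_le μ ((translate v₀ 1 G - translate v 1 G).comp E)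
  have h2 : ∫ x, ((translate v₀ 1 G - translate v 1 G).comp E) x ∂μ =
      ∫ x, translate v₀ 1 G (e n x) ∂μ - ∫ x, translate v 1 G (e n x) ∂μ :=
    integral_sub_continuousMap μ ((translate v₀ 1 G).comp E) ((translate v 1 G).comp E)
  rw [← h2]
  refine this.trans_lt (lt_of_le_of_lt ?_ hv)
  rw [dist_comm, dist_eq_norm]
  exact (ContinuousMap.norm_le _ (norm_nonneg _)).2 fun x =>
    ContinuousMap.norm_coe_le_norm (translate v₀ 1 G - translate v 1 G) _

end Commutators

section Characters

open scoped commutatorElement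

variable {K : Type*} [Group K] [TopologicalSpace K] [IsTopologicalGroup K] [CompactSpace K]

lemma Irred.le_of_translate_commutator_sub_mem {U M : Submodule ℂ C(K, ℂ)} (hU : Irred U)
    (hne : ∃ u ∈ U, ∃ a b : K, translate ⁅a, b⁆ 1 u ≠ u)
    (hM : ∀ (g : C(K, ℂ)) (a b : K), translate ⁅a, b⁆ 1 g - g ∈ M) : U ≤ M := by
  have := hU.repr.fin
  let S : Set C(K, ℂ) := {h | ∃ g ∈ U, ∃ a b : K, h = translate ⁅a, b⁆ 1 g - g}
  have hSU : Submodule.span ℂ S ≤ U := by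
    rw [Submodule.span_le]
    rintro _ ⟨g, hg, a, b, rfl⟩
    exact U.sub_mem (hU.repr.biInv _ _ g hg) hg
  have hS : IsRepr (Submodule.span ℂ S) := by
    refine ⟨Submodule.finiteDimensional_of_le hSU, fun x y f hf => ?_⟩
    have hle : Submodule.span ℂ S ≤
        (Submodule.span ℂ S).comap ((translate x y : C(K, ℂ) →⋆ₐ[ℂ] C(K, ℂ)) : C(K, ℂ) →ₗ[ℂ] C(K, ℂ)) := by
      rw [Submodule.span_le]
      rintro _ ⟨g, hg, a, b, rfl⟩
      refine Submodule.subset_span ⟨translate x y g, hU.repr.biInv x y g hg, x⁻¹ * a * x,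
        x⁻¹ * b * x, ?_⟩
      change translate x y (translate ⁅a, b⁆ 1 g - g) = _
      rw [map_sub, translate_translate, translate_translate]
      congr 3
      · simp only [commutatorElement_def]
        group
      · simp
    exact hle hf
  have hS0 : Submodule.span ℂ S ≠ ⊥ := by
    obtain ⟨u, hu, a, b, hab⟩ := hne
    intro h0
    have hm : translate ⁅a, b⁆ 1 u - u ∈ Submodule.span ℂ S :=
      Submodule.subset_span ⟨u, hu, a, b, rfl⟩
    rw [h0, Submodule.mem_bot, sub_eq_zero] at hm
    exact hab hm
  rw [← hU.min _ hS hSU hS0, Submodule.span_le]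
  rintro _ ⟨g, _, a, b, rfl⟩
  exact hM g a b

/-- A character as a continuous function. -/
noncomputable def charFun (χ : K →ₜ* ℂˣ) : C(K, ℂ) :=
  ⟨fun x => (χ x : ℂ), Units.continuous_val.comp (map_continuous χ)⟩

@[simp] lemma charFun_apply (χ : K →ₜ* ℂˣ) (x : K) : charFun χ x = (χ x : ℂ) := rfl

lemma Irred.exists_eigenvalue {U : Submodule ℂ C(K, ℂ)} (hU : Irred U)
    (hc : ∀ u ∈ U, ∀ a b : K, translate ⁅a, b⁆ 1 u = u) (x : K) :
    ∃ c : ℂ, ∀ u ∈ U, translate x 1 u = c • u := by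
  have := hU.repr.fin
  have : Nontrivial U := (Submodule.nontrivial_iff_ne_bot).2 hU.ne_bot
  let τ : C(K, ℂ) →ₗ[ℂ] C(K, ℂ) := ((translate x 1 : C(K, ℂ) →⋆ₐ[ℂ] C(K, ℂ)) : C(K, ℂ) →ₗ[ℂ] C(K, ℂ))
  have hτ : ∀ g, τ g = translate x 1 g := fun _ => rfl
  let T : Module.End ℂ U := τ.restrict fun g hg => hU.repr.biInv x 1 g hg
  obtain ⟨c, hcT⟩ := Module.End.exists_eigenvalue T
  obtain ⟨u, hu⟩ := hcT.exists_hasEigenvector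
  let E : Submodule ℂ C(K, ℂ) := LinearMap.ker (τ - c • LinearMap.id)
  have hE : ∀ g, g ∈ E ↔ translate x 1 g = c • g := by
    intro g
    simp [E, LinearMap.mem_ker, sub_eq_zero, hτ]
  have hsub : IsRepr (U ⊓ E) := by
    refine ⟨Submodule.finiteDimensional_of_le inf_le_left, fun a b g hg => ?_⟩
    have hgU := hU.repr.biInv a b g hg.1
    refine ⟨hgU, (hE _).2 ?_⟩
    rw [← map_smul, ← (hE g).1 hg.2, translate_translate, translate_translate]
    have h1 : a * x = ⁅a, x⁆ * (x * a) := by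
      rw [commutatorElement_def]
      group
    rw [h1, ← mul_one (1 * b), ← translate_translate, hc g hg.1]
    simp
  have h0 : U ⊓ E ≠ ⊥ := by
    intro h0
    have hmem : (u : C(K, ℂ)) ∈ U ⊓ E :=
      ⟨u.2, (hE _).2 (congrArg Subtype.val hu.apply_eq_smul)⟩
    rw [h0, Submodule.mem_bot] at hmem
    exact hu.2 (Subtype.ext hmem)
  have hEU := hU.min _ hsub inf_le_left h0
  refine ⟨c, fun v hv => (hE v).1 ?_⟩
  rw [← hEU] at hv
  exact hv.2

lemma Irred.exists_charFun {U : Submodule ℂ C(K, ℂ)} (hU : Irred U)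
    (hc : ∀ u ∈ U, ∀ a b : K, translate ⁅a, b⁆ 1 u = u) :
    ∃ χ : K →ₜ* ℂˣ, ∀ u ∈ U, u = u 1 • charFun χ := by
  choose c hcu using hU.exists_eigenvalue hc
  have hval : ∀ u ∈ U, ∀ x y, u (x * y) = c x * u y := fun u hu x y => by
    simpa using congrArg (fun g : C(K, ℂ) => g y) (hcu x u hu)
  obtain ⟨u, hu, hu0⟩ := (Submodule.ne_bot_iff U).1 hU.ne_bot
  have hu1 : u 1 ≠ 0 := by
    intro h1
    apply hu0
    ext x
    have := hval u hu x 1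
    rw [mul_one, h1, mul_zero] at this
    exact this
  have hcx : ∀ x, c x = u x / u 1 := fun x => by
    have := hval u hu x 1
    rw [mul_one] at this
    rw [this, mul_div_cancel_right₀ _ hu1]
  have hc1 : c 1 = 1 := by rw [hcx, div_self hu1]
  have hmul : ∀ x y, c (x * y) = c x * c y := fun x y => by
    rw [hcx (x * y), hval u hu, hcx y, mul_div_assoc]
  have hne : ∀ x, c x ≠ 0 := fun x h => by
    have := hmul x x⁻¹
    rw [mul_inv_cancel, hc1, h, zero_mul] at this
    exact one_ne_zero this
  have hcont : Continuous c := by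
    rw [show c = fun x => u x / u 1 from funext hcx]
    fun_prop
  let χ : K →ₜ* ℂˣ :=
    { toFun := fun x => Units.mk0 (c x) (hne x)
      map_one' := Units.ext hc1
      map_mul' := fun x y => Units.ext (hmul x y)
      continuous_toFun := Units.continuous_iff.2 ⟨hcont, by
        change Continuous fun x => ((Units.mk0 (c x) (hne x))⁻¹ : ℂˣ).val
        simp only [Units.val_inv_eq_inv_val, Units.val_mk0]
        exact hcont.inv₀ hne⟩ }
  refine ⟨χ, fun v hv => ?_⟩
  ext x
  have := hval v hv x 1
  rw [mul_one] at this
  rw [ContinuousMap.smul_apply, smul_eq_mul, mul_comm]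
  exact this

/-- Composition of characters with an automorphism. -/
noncomputable def charPull (γ : ↥(ContAut K)) : Additive (K →ₜ* ℂˣ) →+ Additive (K →ₜ* ℂˣ) :=
  MonoidHom.toAdditive
    { toFun := fun χ => χ.comp ⟨(γ : MulAut K).toMonoidHom, ContAut.continuous γ⟩
      map_one' := rfl
      map_mul' := fun _ _ => rfl }

lemma charPull_apply (γ : ↥(ContAut K)) (χ : Additive (K →ₜ* ℂˣ)) (x : K) :
    (charPull γ χ).toMul x = χ.toMul ((γ : MulAut K) x) := rfl

lemma charPull_iterate_apply (γ : ↥(ContAut K)) (k : ℕ) (χ : Additive (K →ₜ* ℂˣ)) (x : K) :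
    ((charPull γ)^[k] χ).toMul x = χ.toMul (((γ ^ k : ↥(ContAut K)) : MulAut K) x) := by
  induction k generalizing χ with
  | zero => rfl
  | succ k ih =>
    rw [Function.iterate_succ_apply, ih, charPull_apply, pow_succ']
    rfl

lemma charPull_injective (γ : ↥(ContAut K)) : Function.Injective (charPull γ) := by
  intro χ ψ h
  apply Additive.toMul.injective
  ext x
  have h1 := congrArg (fun φ : Additive (K →ₜ* ℂˣ) => φ.toMul ((γ : MulAut K).symm x)) h
  simp only [charPull_apply, MulEquiv.apply_symm_apply] at h1
  rw [h1]

lemma charFun_mem_finAlg (χ : K →ₜ* ℂˣ) {γ : ↥(ContAut K)} (h : pull γ (charFun χ) = charFun χ) :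
    charFun χ ∈ finAlg (Subgroup.zpowers γ) := by
  refine mem_finAlg'.2 ⟨Submodule.span ℂ {charFun χ}, ⟨inferInstance, ?_⟩, ?_,
    Submodule.mem_span_singleton_self _⟩
  · intro a b f hf
    obtain ⟨c, rfl⟩ := Submodule.mem_span_singleton.1 hf
    refine Submodule.mem_span_singleton.2 ⟨c * χ a * χ b, ?_⟩
    ext x
    simp
    ring
  · rw [Subgroup.zpowers_le, mem_pullStab, Submodule.map_span, image_singleton]
    exact congrArg (fun g => Submodule.span ℂ {g}) h

variable [MeasurableSpace K] [BorelSpace K] (μ : Measure K) [μ.IsHaarMeasure]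
  [IsProbabilityMeasure μ]

lemma integral_charFun {χ : K →ₜ* ℂˣ} (h : χ ≠ 1) : ∫ x, charFun χ x ∂μ = 0 := by
  obtain ⟨a, ha⟩ : ∃ a, χ a ≠ 1 := by
    by_contra! h1
    exact h (by ext x; simp [h1])
  have h1 := integral_translate μ a 1 (charFun χ)
  have h2 : translate a 1 (charFun χ) = (χ a : ℂ) • charFun χ := by
    ext x
    simp
  rw [h2, integral_smul_continuousMap] at h1
  have h3 : ((χ a : ℂ) - 1) * ∫ x, charFun χ x ∂μ = 0 := by rw [sub_mul, h1]; ring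
  refine (mul_eq_zero.1 h3).resolve_left fun h0 => ha ?_
  exact Units.ext (sub_eq_zero.1 h0)

variable {ι : Type*} [Fintype ι] [DecidableEq ι] {γ : ↥(ContAut K)}

lemma Mix.smul {f : ι → C(K, ℂ)} (h : Mix μ γ f) (c : ι → ℂ) : Mix μ γ fun i => c i • f i := by
  have h1 : ∀ n, prodPull γ (fun i => c i • f i) n = (∏ i, c i) • prodPull γ f n := by
    intro n
    simp only [prodPull, map_smul, Finset.prod_smul]
  simp only [Mix, h1, integral_smul_continuousMap, Finset.prod_mul_distrib]
  exact h.const_mul _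

lemma mix_charFun (hγ : finAlg (Subgroup.zpowers γ) = ⊥) (χ : ι → (K →ₜ* ℂˣ)) :
    Mix μ γ fun i => charFun (χ i) := by
  by_cases hall : ∀ i, χ i = 1
  · have h1 : charFun (1 : K →ₜ* ℂˣ) = 1 := by ext; rfl
    have h2 : ∀ n : ι → ℤ, prodPull γ (fun _ => (1 : C(K, ℂ))) n = 1 := fun n => by simp [prodPull]
    simp only [Mix, hall, h1, h2]
    simpa using tendsto_const_nhds
  have haper : ∀ k, 0 < k → ∀ ψ : Additive (K →ₜ* ℂˣ), (charPull γ)^[k] ψ = ψ → ψ = 0 := by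
    intro k hk ψ hψ
    have h1 : pull (γ ^ k) (charFun ψ.toMul) = charFun ψ.toMul := by
      ext x
      rw [pull_apply, charFun_apply, charFun_apply, ← charPull_iterate_apply, hψ]
    have h2 := mem_finAlg_of_pow hk (charFun_mem_finAlg _ h1)
    rw [hγ, mem_bot_iff_forall_eq] at h2
    apply Additive.toMul.injective
    ext x
    have := h2 x 1
    simpa using this
  obtain ⟨N, hN⟩ := exists_gap_of_aperiodic (ι := ι) (charPull γ) (charPull_injective γ) haper
    fun i => Additive.ofMul (χ i)
  have hrhs : ∏ i, ∫ x, charFun (χ i) x ∂μ = 0 := by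
    push Not at hall
    obtain ⟨i, hi⟩ := hall
    exact Finset.prod_eq_zero (Finset.mem_univ i) (integral_charFun μ hi)
  rw [Mix, hrhs]
  refine tendsto_const_nhds.congr' (eventually_gapFilter.2 ⟨N, fun n hn => ?_⟩)
  let M : ℤ := ∑ i, |n i|
  have hM : ∀ i, 0 ≤ n i + M := fun i => by
    have := Finset.single_le_sum (f := fun i => |n i|) (fun i _ => abs_nonneg _) (Finset.mem_univ i)
    have := neg_abs_le (n i)
    simp only [M]
    linarith
  have hcast : ∀ i, (((n i + M).toNat : ℕ) : ℤ) = n i + M := fun i => Int.toNat_of_nonneg (hM i)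
  let ψ : Additive (K →ₜ* ℂˣ) := ∑ i, (charPull γ)^[(n i + M).toNat] (Additive.ofMul (χ i))
  have hψ : pull (γ ^ M) (prodPull γ (fun i => charFun (χ i)) n) = charFun ψ.toMul := by
    let E : (K →ₜ* ℂˣ) →* C(K, ℂ) :=
      { toFun := charFun
        map_one' := by ext; rfl
        map_mul' := fun _ _ => by ext; rfl }
    change _ = E ψ.toMul
    rw [toMul_sum, map_prod, prodPull, map_prod]
    refine Finset.prod_congr rfl fun i _ => ?_
    rw [pull_pull, ← zpow_add, ← hcast, zpow_natCast]
    ext x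
    exact congrArg Units.val (charPull_iterate_apply γ _ (Additive.ofMul (χ i)) x).symm
  change 0 = ∫ x, prodPull γ (fun i => charFun (χ i)) n x ∂μ
  rw [← integral_pull μ (γ ^ M), hψ, integral_charFun]
  intro h0
  have h0' : ψ = 0 := Additive.toMul.injective h0
  have := hN (fun i => (n i + M).toNat) (fun i j hij => by
    simpa [hcast] using hn i j hij) h0'
  exact hall fun i => Additive.ofMul.injective (this i)

end Characters

section Main

open scoped commutatorElement

variable {K : Type*} [Group K] [TopologicalSpace K] [IsTopologicalGroup K] [CompactSpace K]

lemma irred_one : Irred (1 : Submodule ℂ C(K, ℂ)) := by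
  refine ⟨⟨Module.Finite.iff_fg.2 (Submodule.one_eq_span (R := ℂ) (A := C(K, ℂ)) ▸
    Submodule.fg_span_singleton 1), ?_⟩, ?_, ?_⟩
  · intro a b f hf
    obtain ⟨c, rfl⟩ := Submodule.mem_one.1 hf
    rw [AlgHomClass.commutes]
    exact hf
  · refine (Submodule.ne_bot_iff _).2 ⟨1, Submodule.one_le.1 le_rfl, fun h => ?_⟩
    simpa using congrArg (fun g : C(K, ℂ) => g 1) h
  · intro W _ hW h0
    refine le_antisymm hW fun f hf => ?_
    obtain ⟨w, hw, hw0⟩ := (Submodule.ne_bot_iff W).1 h0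
    obtain ⟨c, rfl⟩ := Submodule.mem_one.1 (hW hw)
    obtain ⟨d, rfl⟩ := Submodule.mem_one.1 hf
    have hc : c ≠ 0 := fun hc => hw0 (by simp [hc])
    have : algebraMap ℂ C(K, ℂ) d = (d / c) • algebraMap ℂ C(K, ℂ) c := by
      rw [Algebra.smul_def, ← map_mul, div_mul_cancel₀ _ hc]
    rw [this]
    exact W.smul_mem _ hw

/-- The space of complex conjugates of the functions in `U`. -/
noncomputable def conjSpace (U : Submodule ℂ C(K, ℂ)) : Submodule ℂ C(K, ℂ) :=
  U.map (starLinearEquiv ℂ : C(K, ℂ) ≃ₗ⋆[ℂ] C(K, ℂ)).toLinearMap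

lemma mem_conjSpace {U : Submodule ℂ C(K, ℂ)} {f : C(K, ℂ)} : f ∈ conjSpace U ↔ star f ∈ U := by
  constructor
  · rintro ⟨g, hg, rfl⟩
    change star (star g) ∈ U
    rwa [star_star]
  · intro h
    exact ⟨star f, h, star_star f⟩

lemma conjSpace_conjSpace (U : Submodule ℂ C(K, ℂ)) : conjSpace (conjSpace U) = U := by
  ext f
  rw [mem_conjSpace, mem_conjSpace, star_star]

lemma conjSpace_mono {U V : Submodule ℂ C(K, ℂ)} (h : U ≤ V) : conjSpace U ≤ conjSpace V :=
  Submodule.map_mono h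

lemma IsRepr.conjSpace {U : Submodule ℂ C(K, ℂ)} (hU : IsRepr U) : IsRepr (conjSpace U) := by
  refine ⟨Module.Finite.iff_fg.2 ((Module.Finite.iff_fg.1 hU.fin).map _), fun a b f hf => ?_⟩
  rw [SetLike.mem_coe, mem_conjSpace] at hf ⊢
  rw [← map_star]
  exact hU.biInv a b _ hf

lemma Irred.conjSpace {U : Submodule ℂ C(K, ℂ)} (hU : Irred U) : Irred (conjSpace U) := by
  have hb : ∀ {W : Submodule ℂ C(K, ℂ)}, W ≠ ⊥ → ErgZd.conjSpace W ≠ ⊥ := fun {W} hW h => hW (by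
    rw [← conjSpace_conjSpace W, h, ErgZd.conjSpace, Submodule.map_bot])
  refine ⟨hU.repr.conjSpace, hb hU.ne_bot, fun W hW hle h0 => ?_⟩
  rw [← conjSpace_conjSpace W]
  congr 1
  refine hU.min _ hW.conjSpace ?_ (hb h0)
  rw [← conjSpace_conjSpace U]
  exact conjSpace_mono hle

variable [MeasurableSpace K] [BorelSpace K] {μ : Measure K} [μ.IsHaarMeasure]
  [IsProbabilityMeasure μ]
  {ι : Type*} [Fintype ι] [DecidableEq ι] {γ : ↥(ContAut K)}

lemma mix_of_eq_one_off_singleton {f : ι → C(K, ℂ)} {i : ι} (hf : ∀ k, k ≠ i → f k = 1) :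
    Mix μ γ f := by
  have h1 : ∀ n, ∫ x, prodPull γ f n x ∂μ = ∫ x, f i x ∂μ := fun n => by
    rw [prodPull, Finset.prod_eq_single i (fun k _ hk => by rw [hf k hk, map_one]) (by simp),
      integral_pull]
  have h2 : ∏ k, ∫ x, f k x ∂μ = ∫ x, f i x ∂μ :=
    Finset.prod_eq_single i (fun k _ hk => by simp [hf k hk]) (by simp)
  rw [Mix, h2]
  simp_rw [h1]
  exact tendsto_const_nhds

lemma mix_of_eq_one_off_pair (hγ : finAlg (Subgroup.zpowers γ) = ⊥) {f : ι → C(K, ℂ)} {i j : ι}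
    (hij : i ≠ j) (hf : ∀ k, k ≠ i → k ≠ j → f k = 1) {U V : Submodule ℂ C(K, ℂ)} (hU : Irred U)
    (hV : Irred V) (hfU : f i ∈ U) (hfV : f j ∈ V) (hU1 : U ≠ 1) : Mix μ γ f := by
  have hintg : ∫ x, f i x ∂μ = 0 := by
    rw [← ip_one_left μ]
    exact irred_one.ip_eq_zero μ hU hU1.symm (Submodule.one_le.1 le_rfl) hfU
  have hrhs : ∏ k, ∫ x, f k x ∂μ = 0 := Finset.prod_eq_zero (Finset.mem_univ i) hintg
  rw [Mix, hrhs]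
  have hW : ¬ ∀ g ∈ conjSpace U, g ∈ finAlg (Subgroup.zpowers γ) := by
    intro h
    apply hU1
    refine irred_one.min U hU.repr (fun g hg => ?_) hU.ne_bot
    have h1 := h (star g) (mem_conjSpace.2 (by rwa [star_star]))
    rw [hγ, star_mem_iff, StarSubalgebra.mem_bot] at h1
    exact Submodule.mem_one.2 h1
  obtain ⟨N, hN⟩ : ∃ N : ℕ, ∀ d : ℤ, (N : ℤ) ≤ |d| → (conjSpace U).map (pullₗ (γ ^ d)) ≠ V := by
    by_cases hk : ∃ k : ℤ, (conjSpace U).map (pullₗ (γ ^ k)) = V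
    · obtain ⟨k, rfl⟩ := hk
      refine ⟨k.natAbs + 1, fun d hd => hU.conjSpace.map_pull_injective hW ?_⟩
      rintro rfl
      push_cast at hd
      omega
    · push Not at hk
      exact ⟨0, fun d _ => hk d⟩
  refine tendsto_const_nhds.congr' (eventually_gapFilter.2 ⟨N, fun n hn => ?_⟩)
  have h1 : prodPull γ f n = star (pull (γ ^ n i) (star (f i))) * pull (γ ^ n j) (f j) := by
    rw [prodPull, Finset.prod_eq_mul i j hij
      (fun k _ hk => by rw [hf k hk.1 hk.2, map_one]) (by simp) (by simp), map_star, star_star]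
  change 0 = ∫ x, prodPull γ f n x ∂μ
  rw [h1, ← ip_def]
  refine ((hU.conjSpace.map_pull (γ ^ n i)).ip_eq_zero μ (hV.map_pull (γ ^ n j)) (fun heq => ?_)
    (pull_mem_map (mem_conjSpace.2 (by rwa [star_star]))) (pull_mem_map hfV)).symm
  apply hN (n i - n j) (hn i j hij)
  have h2 := congrArg (fun W => Submodule.map (pullₗ (γ ^ (-n j))) W) heq
  simp only [map_pull_map_pull, ← zpow_add] at h2
  rw [add_neg_cancel, zpow_zero, map_pull_one] at h2
  rw [sub_eq_add_neg, h2]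

lemma mix_of_irred [T2Space K] (hγ : finAlg (Subgroup.zpowers γ) = ⊥) {s : Finset ι}
    (ih : ∀ t ⊂ s, MixOn μ γ t) {f : ι → C(K, ℂ)} (hf : ∀ i ∉ s, f i = 1)
    {U : ι → Submodule ℂ C(K, ℂ)} (hU : ∀ i ∈ s, Irred (U i)) (hfU : ∀ i ∈ s, f i ∈ U i) :
    Mix μ γ f := by
  by_cases hc : ∀ i ∈ s, ∀ u ∈ U i, ∀ a b : K, translate ⁅a, b⁆ 1 u = u
  · have hχ : ∀ i, ∃ χ : K →ₜ* ℂˣ, f i = f i 1 • charFun χ := by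
      intro i
      by_cases hi : i ∈ s
      · obtain ⟨χ, h⟩ := (hU i hi).exists_charFun (hc i hi)
        exact ⟨χ, h _ (hfU i hi)⟩
      · refine ⟨1, ?_⟩
        rw [hf i hi]
        ext x
        simp
    choose χ hχ using hχ
    rw [show f = fun i => f i 1 • charFun (χ i) from funext hχ]
    exact (mix_charFun μ hγ χ).smul μ fun i => f i 1
  push Not at hc
  obtain ⟨i, hi, hnc⟩ := hc
  have hU1 : U i ≠ 1 := by
    intro h1
    obtain ⟨u, hu, a, b, hab⟩ := hnc
    rw [h1] at hu
    obtain ⟨c, rfl⟩ := Submodule.mem_one.1 hu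
    exact hab (AlgHomClass.commutes _ _)
  by_cases hj : ∃ j ∈ s, j ≠ i
  swap
  · push Not at hj
    exact mix_of_eq_one_off_singleton (i := i) fun k hk => hf k fun hks => hk (hj k hks)
  obtain ⟨j, hjs, hji⟩ := hj
  by_cases hk : ∃ k ∈ s, k ≠ i ∧ j ≠ k
  · obtain ⟨k, hks, hki, hjk⟩ := hk
    rw [← mem_mixSpace_self μ γ f i]
    exact (hU i hi).le_of_translate_commutator_sub_mem hnc
      (translate_commutator_sub_mem_mixSpace hi hji hki hjk (ih _ (Finset.erase_ssubset hjs))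
        (ih _ (Finset.erase_ssubset hks)) hf) (hfU i hi)
  · push Not at hk
    exact mix_of_eq_one_off_pair hγ hji.symm
      (fun k hki hkj => hf k fun hks => hkj (hk k hks hki).symm) (hU i hi) (hU j hjs)
      (hfU i hi) (hfU j hjs) hU1

lemma mixOn [TopologicalSpace.MetrizableSpace K] (hγ : finAlg (Subgroup.zpowers γ) = ⊥)
    (s : Finset ι) : MixOn μ γ s := by
  induction s using Finset.strongInduction with
  | _ s ih =>
    suffices h : ∀ (t : Finset ι) (f : ι → C(K, ℂ)), (∀ i ∉ s, f i = 1) →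
        (∀ i ∈ s, i ∉ t → ∃ U, Irred U ∧ f i ∈ U) → Mix μ γ f from
      fun f hf => h s f hf fun i hi hi' => absurd hi hi'
    intro t
    induction t using Finset.induction_on with
    | empty =>
      intro f hf hfU
      have : ∀ i, ∃ U, i ∈ s → Irred U ∧ f i ∈ U := fun i => by
        by_cases hi : i ∈ s
        · obtain ⟨U, hU⟩ := hfU i hi (Finset.notMem_empty i)
          exact ⟨U, fun _ => hU⟩
        · exact ⟨⊥, fun h => absurd h hi⟩
      choose U hU using this
      exact mix_of_irred hγ ih hf (fun i hi => (hU i hi).1) fun i hi => (hU i hi).2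
    | insert i t _ iht =>
      intro f hf hfU
      by_cases hi : i ∈ s
      swap
      · refine iht f hf fun k hks hkt => hfU k hks fun hk => ?_
        rcases Finset.mem_insert.1 hk with rfl | hk
        · exact hi hks
        · exact hkt hk
      rw [← mem_mixSpace_self μ γ f i]
      refine mem_of_isClosed_of_irred μ (isClosed_mixSpace μ γ f i) (fun U hU g hg => ?_) _
      rw [mem_mixSpace]
      refine iht _ (fun k hk => ?_) fun k hks hkt => ?_
      · have hki : k ≠ i := fun h => hk (h ▸ hi)
        rw [Function.update_of_ne hki, hf k hk]
      · by_cases hki : k = i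
        · subst hki
          exact ⟨U, hU, by rwa [Function.update_self]⟩
        · rw [Function.update_of_ne hki]
          exact hfU k hks fun h => (Finset.mem_insert.1 h).elim hki hkt

/-- An automorphism without nonconstant finite orbits of representative functions is mixing of
all orders on continuous functions. -/
lemma mix [TopologicalSpace.MetrizableSpace K] (hγ : finAlg (Subgroup.zpowers γ) = ⊥)
    (f : ι → C(K, ℂ)) : Mix μ γ f :=
  mixOn hγ Finset.univ f fun i hi => absurd (Finset.mem_univ i) hi

end Main

lemma abs_prod_sub_prod_le {ι : Type*} (s : Finset ι) {a b : ι → ℝ}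
    (ha : ∀ i ∈ s, a i ∈ Icc (0 : ℝ) 1) (hb : ∀ i ∈ s, b i ∈ Icc (0 : ℝ) 1) :
    |∏ i ∈ s, a i - ∏ i ∈ s, b i| ≤ ∑ i ∈ s, |a i - b i| := by
  classical
  induction s using Finset.induction_on with
  | empty => simp
  | insert i s hi ih =>
    rw [Finset.prod_insert hi, Finset.prod_insert hi, Finset.sum_insert hi]
    have hai := ha i (Finset.mem_insert_self i s)
    have ha' := fun j hj => ha j (Finset.mem_insert_of_mem (a := j) (b := i) (s := s) hj)
    have hb' := fun j hj => hb j (Finset.mem_insert_of_mem (a := j) (b := i) (s := s) hj)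
    have hB0 : 0 ≤ ∏ j ∈ s, b j := Finset.prod_nonneg fun j hj => (hb' j hj).1
    have hB1 : ∏ j ∈ s, b j ≤ 1 := Finset.prod_le_one (fun j hj => (hb' j hj).1)
      fun j hj => (hb' j hj).2
    have hih := ih ha' hb'
    have heq : a i * ∏ j ∈ s, a j - b i * ∏ j ∈ s, b j =
        a i * (∏ j ∈ s, a j - ∏ j ∈ s, b j) + (a i - b i) * ∏ j ∈ s, b j := by ring
    rw [heq]
    refine (abs_add_le _ _).trans ?_
    rw [abs_mul, abs_mul, abs_of_nonneg hai.1, abs_of_nonneg hB0, add_comm]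
    exact add_le_add (mul_le_of_le_one_right (abs_nonneg _) hB1)
      ((mul_le_of_le_one_left (abs_nonneg _) hai.2).trans hih)

lemma exists_continuousMap_integral_indicator_sub_le {X : Type*} [TopologicalSpace X]
    [TopologicalSpace.MetrizableSpace X] [MeasurableSpace X] [BorelSpace X] (μ : Measure X)
    [IsFiniteMeasure μ] {A : Set X} (hA : MeasurableSet A) {δ : ℝ} (hδ : 0 < δ) :
    ∃ h : C(X, ℝ), (∀ x, h x ∈ Icc (0 : ℝ) 1) ∧ ∫ x, |A.indicator 1 x - h x| ∂μ ≤ δ := by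
  have hδ' : ENNReal.ofReal (δ / 2) ≠ 0 := by simpa using hδ
  obtain ⟨F, hFA, hF, hFδ⟩ := hA.exists_isClosed_sdiff_lt (measure_ne_top μ A) hδ'
  obtain ⟨O, hAO, hO, _, hOδ⟩ := hA.exists_isOpen_sdiff_lt (measure_ne_top μ A) hδ'
  obtain ⟨h, h0, h1, h2⟩ := exists_continuous_zero_one_of_isClosed hO.isClosed_compl hF
    (disjoint_left.2 fun x hx hxF => hx (hAO (hFA hxF)))
  refine ⟨h, h2, ?_⟩
  have hle : ∀ x, |A.indicator 1 x - h x| ≤ ((O \ A) ∪ (A \ F)).indicator (1 : X → ℝ) x := by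
    intro x
    have hx := h2 x
    by_cases hxO : x ∈ O
    · by_cases hxF : x ∈ F
      · have hxA := hFA hxF
        simp [hxA, hxF, h1 hxF]
      · have hmem : x ∈ (O \ A) ∪ (A \ F) := by
          by_cases hxA : x ∈ A
          · exact Or.inr ⟨hxA, hxF⟩
          · exact Or.inl ⟨hxO, hxA⟩
        rw [indicator_of_mem hmem]
        by_cases hxA : x ∈ A
        · rw [indicator_of_mem hxA, abs_le]
          simp only [Pi.one_apply]
          constructor <;> linarith [hx.1, hx.2]
        · rw [indicator_of_notMem hxA, abs_le]
          simp only [Pi.one_apply]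
          constructor <;> linarith [hx.1, hx.2]
    · have hxA : x ∉ A := fun hxA => hxO (hAO hxA)
      have h0x : h x = 0 := h0 hxO
      rw [indicator_of_notMem hxA, h0x, sub_zero, abs_zero]
      exact indicator_nonneg (fun _ _ => zero_le_one) _
  have hm : MeasurableSet ((O \ A) ∪ (A \ F)) :=
    (hO.measurableSet.diff hA).union (hA.diff hF.measurableSet)
  calc ∫ x, |A.indicator 1 x - h x| ∂μ
      ≤ ∫ x, ((O \ A) ∪ (A \ F)).indicator (1 : X → ℝ) x ∂μ :=
        integral_mono_of_nonneg (.of_forall fun _ => abs_nonneg _)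
          ((integrable_const (1 : ℝ)).indicator hm) (.of_forall hle)
    _ = μ.real ((O \ A) ∪ (A \ F)) := integral_indicator_one hm
    _ ≤ μ.real (O \ A) + μ.real (A \ F) := measureReal_union_le _ _
    _ ≤ δ / 2 + δ / 2 := by
        gcongr
        · exact ENNReal.toReal_le_of_le_ofReal (by positivity) hOδ.le
        · exact ENNReal.toReal_le_of_le_ofReal (by positivity) hFδ.le
    _ = δ := by ring

section Borel

variable {K : Type*} [Group K] [TopologicalSpace K] [IsTopologicalGroup K] [CompactSpace K]
  [TopologicalSpace.MetrizableSpace K] [MeasurableSpace K] [BorelSpace K] {μ : Measure K}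
  [μ.IsHaarMeasure] [IsProbabilityMeasure μ] {γ : ↥(ContAut K)}

lemma mixingAllOrders (hγ : finAlg (Subgroup.zpowers γ) = ⊥) : MixingAllOrders μ γ := by
  intro r hr A hA ε hε
  have hr0 : (0 : ℝ) < r := by
    have : 0 < r := by omega
    exact_mod_cast this
  have hδ : 0 < ε / (3 * r) := by positivity
  choose h h01 hhδ using fun i => exists_continuousMap_integral_indicator_sub_le μ (hA i) hδ
  let f : Fin r → C(K, ℂ) := fun i => ⟨fun x => (h i x : ℂ), by fun_prop⟩
  have hmix : Mix μ γ f := mix hγ f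
  obtain ⟨N, hN⟩ := eventually_gapFilter.1 ((Metric.tendsto_nhds.1 hmix) (ε / 3) (by positivity))
  refine ⟨N, fun m hm => ?_⟩
  have hN' := hN (fun i => -m i) fun i j hij => by
    have := hm i j hij
    rw [show -m i - -m j = -(m i - m j) by ring, abs_neg]
    exact this
  let e : Fin r → K → K := fun i => ((γ ^ (-m i) : ↥(ContAut K)) : MulAut K)
  have he : ∀ i, MeasurePreserving (e i) μ μ := fun i => measurePreserving_contAut μ _
  have hec : ∀ i, Continuous (e i) := fun i => ContAut.continuous _
  have hpre : ∀ i, ((γ ^ m i : ↥(ContAut K)) : MulAut K) '' A i = e i ⁻¹' A i := by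
    intro i
    have : e i = ⇑((γ ^ m i : ↥(ContAut K)) : MulAut K).symm := by
      simp only [e, zpow_neg]
      rfl
    rw [this]
    exact ((γ ^ m i : ↥(ContAut K)) : MulAut K).toEquiv.image_eq_preimage_symm _
  simp_rw [hpre]
  have hIm : MeasurableSet (⋂ i, e i ⁻¹' A i) :=
    MeasurableSet.iInter fun i => (hec i).measurable (hA i)
  have hind01 : ∀ i x, (A i).indicator (1 : K → ℝ) x ∈ Icc (0 : ℝ) 1 := fun i x => by
    by_cases hx : x ∈ A i <;> simp [hx]
  have hindprod : ∀ x, (⋂ i, e i ⁻¹' A i).indicator (1 : K → ℝ) x =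
      ∏ i, (A i).indicator (1 : K → ℝ) (e i x) := by
    intro x
    by_cases hx : x ∈ ⋂ i, e i ⁻¹' A i
    · rw [indicator_of_mem hx, Finset.prod_eq_one]
      · rfl
      · intro i _
        exact indicator_of_mem (f := (1 : K → ℝ)) (mem_iInter.1 hx i)
    · rw [indicator_of_notMem hx]
      obtain ⟨i, hi⟩ := by simpa using hx
      exact (Finset.prod_eq_zero (Finset.mem_univ i) (indicator_of_notMem hi _)).symm
  have hindint : ∀ i, Integrable ((A i).indicator (1 : K → ℝ)) μ := fun i =>
    (integrable_const (1 : ℝ)).indicator (hA i)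
  have hhint : ∀ i, Integrable (h i) μ := fun i =>
    (h i).continuous.integrable_of_hasCompactSupport (.of_compactSpace _)
  have hdiff : ∀ i, Integrable (fun x => |(A i).indicator (1 : K → ℝ) x - h i x|) μ := fun i =>
    ((hindint i).sub (hhint i)).abs
  have hprodc : Continuous fun x => ∏ i, h i (e i x) :=
    continuous_finsetProd _ fun i _ => (h i).continuous.comp (hec i)
  have hprodint : Integrable (fun x => ∏ i, h i (e i x)) μ :=
    hprodc.integrable_of_hasCompactSupport (.of_compactSpace _)
  have hsum : ∑ _i : Fin r, ε / (3 * r) = ε / 3 := by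
    simp
    field_simp
  have hleft : |(μ (⋂ i, e i ⁻¹' A i)).toReal - ∫ x, ∏ i, h i (e i x) ∂μ| ≤ ε / 3 := by
    have h1 : (μ (⋂ i, e i ⁻¹' A i)).toReal = ∫ x, ∏ i, (A i).indicator (1 : K → ℝ) (e i x) ∂μ := by
      rw [← integral_congr_ae (.of_forall hindprod), integral_indicator_one hIm]
      rfl
    have h2 : Integrable (fun x => ∏ i, (A i).indicator (1 : K → ℝ) (e i x)) μ := by
      rw [← show _ = fun x => ∏ i, (A i).indicator (1 : K → ℝ) (e i x) from funext hindprod]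
      exact (integrable_const (1 : ℝ)).indicator hIm
    rw [h1, ← integral_sub h2 hprodint]
    have hintg : ∀ i, Integrable (fun x => |(A i).indicator (1 : K → ℝ) (e i x) - h i (e i x)|) μ :=
      fun i => (he i).integrable_comp_of_integrable (hdiff i)
    have hle : ∀ x, ‖∏ i, (A i).indicator (1 : K → ℝ) (e i x) - ∏ i, h i (e i x)‖ ≤
        ∑ i, |(A i).indicator (1 : K → ℝ) (e i x) - h i (e i x)| := fun x =>
      abs_prod_sub_prod_le Finset.univ (fun i _ => hind01 i (e i x)) fun i _ => h01 i (e i x)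
    refine (norm_integral_le_of_norm_le (integrable_finsetSum _ fun i _ => hintg i)
      (.of_forall hle)).trans ?_
    rw [integral_finsetSum _ fun i _ => hintg i, ← hsum]
    refine Finset.sum_le_sum fun i _ => ?_
    have h3 := (he i).integral_comp
      ((γ ^ (-m i) : ↥(ContAut K)).1.toEquiv.injective |> fun hinj =>
        ((hec i).isClosedEmbedding hinj).measurableEmbedding)
      fun x => |(A i).indicator (1 : K → ℝ) x - h i x|
    rw [h3]
    exact hhδ i
  have hright : |∏ i, ∫ x, h i x ∂μ - ∏ i, (μ (A i)).toReal| ≤ ε / 3 := by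
    have h1 : ∀ i, (μ (A i)).toReal = ∫ x, (A i).indicator (1 : K → ℝ) x ∂μ := fun i => by
      rw [integral_indicator_one (hA i)]
      rfl
    have h2 : ∀ i, (μ (A i)).toReal ∈ Icc (0 : ℝ) 1 := fun i =>
      ⟨ENNReal.toReal_nonneg, measureReal_le_one⟩
    have h3 : ∀ i, ∫ x, h i x ∂μ ∈ Icc (0 : ℝ) 1 := fun i =>
      ⟨integral_nonneg fun x => (h01 i x).1, by
        simpa using integral_mono (hhint i) (integrable_const (1 : ℝ)) fun x => (h01 i x).2⟩
    refine (abs_prod_sub_prod_le Finset.univ (fun i _ => h3 i) fun i _ => h2 i).trans ?_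
    rw [← hsum]
    refine Finset.sum_le_sum fun i _ => ?_
    rw [h1 i, abs_sub_comm, ← integral_sub (hindint i) (hhint i)]
    exact (abs_integral_le_integral_abs).trans (hhδ i)
  have hmid : |∫ x, ∏ i, h i (e i x) ∂μ - ∏ i, ∫ x, h i x ∂μ| < ε / 3 := by
    have h1 : ∫ x, prodPull γ f (fun i => -m i) x ∂μ = ((∫ x, ∏ i, h i (e i x) ∂μ : ℝ) : ℂ) := by
      rw [← integral_complex_ofReal]
      congr 1
      ext x
      rw [prodPull, ContinuousMap.prod_apply]
      push_cast
      rfl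
    have h2 : ∏ i, ∫ x, f i x ∂μ = ((∏ i, ∫ x, h i x ∂μ : ℝ) : ℂ) := by
      push_cast
      exact Finset.prod_congr rfl fun i _ => integral_complex_ofReal
    rw [h1, h2, Complex.dist_eq, ← Complex.ofReal_sub, Complex.norm_real] at hN'
    exact hN'
  rw [abs_lt]
  rw [abs_le] at hleft hright
  rw [abs_lt] at hmid
  constructor <;> linarith [hleft.1, hleft.2, hright.1, hright.2, hmid.1, hmid.2]

lemma MixingAllOrders.ergSet (h : MixingAllOrders μ γ) {S : Set ↥(ContAut K)}
    (hS : ∀ n : ℤ, γ ^ n ∈ S) : ErgSet μ S := by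
  intro A hA hinv
  have key : ∀ ε : ℝ, 0 < ε → |(μ A).toReal - (μ A).toReal ^ 2| < ε := by
    intro ε hε
    obtain ⟨N, hN⟩ := h 2 le_rfl (fun _ => A) (fun _ => hA) ε hε
    have := hN ![0, (N : ℤ)] (by
      intro i j hij
      fin_cases i <;> fin_cases j <;> simp_all)
    simp_rw [hinv _ (hS _)] at this
    simpa [iInter_const, pow_two] using this
  have h0 : (μ A).toReal - (μ A).toReal ^ 2 = 0 := by
    by_contra hne
    exact lt_irrefl _ (key _ (abs_pos.2 hne))
  have h1 : (μ A).toReal * (1 - (μ A).toReal) = 0 := by rw [← h0]; ring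
  rcases mul_eq_zero.1 h1 with h2 | h2
  · left
    exact ((ENNReal.toReal_eq_zero_iff _).1 h2).resolve_right (measure_ne_top μ A)
  · right
    have h3 : (μ A).toReal = 1 := by linarith
    exact (ENNReal.toReal_eq_one_iff _).1 h3

end Borel

/-- Corollary 4.5, after Rokhlin. Let `Γ` be a finitely generated group
of commuting continuous automorphisms of a compact metrizable group `K` such that the
centre `Z(Γ)` of the action has DCC on `K`. Then `Γ` is ergodic on `K` iff some element of
`Γ` is mixing of all orders. -/
theorem statement14 {K : Type*} [Group K] [TopologicalSpace K] [IsTopologicalGroup K]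
    [CompactSpace K] [TopologicalSpace.MetrizableSpace K]
    [MeasurableSpace K] [BorelSpace K]
    (μ : Measure K) [μ.IsHaarMeasure] [IsProbabilityMeasure μ]
    {n : ℕ} (α : Fin n → ↥(ContAut K))
    (hcomm : ∀ i j, α i * α j = α j * α i)
    (Γ : Subgroup ↥(ContAut K)) (hΓ : Γ = Subgroup.closure (Set.range α))
    (hdcc : HasDCC {β : ↥(ContAut K) | ∀ γ ∈ Γ, β * γ = γ * β}) :
    ErgSet μ (Γ : Set ↥(ContAut K)) ↔ ∃ a ∈ Γ, MixingAllOrders μ a := by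
  constructor
  · intro herg
    have hcommΓ : ∀ γ ∈ Γ, ∀ δ ∈ Γ, γ * δ = δ * γ := by
      have := Subgroup.isMulCommutative_closure (k := Set.range α) (by
        rintro _ ⟨i, rfl⟩ _ ⟨j, rfl⟩
        exact hcomm i j)
      rw [← hΓ] at this
      intro γ hγ δ hδ
      exact congrArg Subtype.val (this.is_comm.comm ⟨γ, hγ⟩ ⟨δ, hδ⟩)
    let _ : CommGroup ↥Γ :=
      { mul_comm := fun γ δ => Subtype.ext (hcommΓ γ γ.2 δ δ.2) }
    have hfg : Group.FG ↥Γ := by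
      rw [Group.fg_iff_subgroup_fg, Subgroup.fg_iff]
      exact ⟨Set.range α, hΓ.symm, Set.finite_range α⟩
    have hwf : WellFoundedGT (Subgroup ↥Γ) := wellFoundedGT_subgroup
    let Z : Subgroup ↥(ContAut K) := Subgroup.centralizer Γ
    have hZ : ∀ β, β ∈ Z ↔ ∀ γ ∈ Γ, β * γ = γ * β := fun β => by
      rw [Subgroup.mem_centralizer_iff]
      exact forall₂_congr fun γ _ => eq_comm
    have hdcc' : HasDCC (Z : Set ↥(ContAut K)) := by
      rwa [show (Z : Set ↥(ContAut K)) = {β | ∀ γ ∈ Γ, β * γ = γ * β} from Set.ext hZ]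
    have hwf' := hdcc'.wellFoundedGT μ
    obtain ⟨γ, hγ, h⟩ := exists_finAlg_eq_bot μ hZ hcommΓ herg.finAlg_eq_bot
    exact ⟨γ, hγ, mixingAllOrders h⟩
  · rintro ⟨a, ha, hmix⟩
    exact hmix.ergSet fun n => Γ.zpow_mem ha n

end ErgZd
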